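/- Suppose δ is a measurable-limit-style large cardinal witnessed by an elementary embedding j : V → M with critical point δ and M closed under |V_{δ+ω+2}|-sequences. Then for every A ⊆ δ there are stationarily many κ < δ such that there is an elementary embedding i : V → N with critical point κ, j''... specifically: κ is [|V_{κ+ω}|] A-superstrong, i.e., there is an elementary embedding i : V → N with crit(i) = κ, i(A) ∩ i(κ) = A ∩ i(κ), and i''V_{κ+ω} ∈ N. (Stationarily many: for every club C ⊆ δ there is such κ ∈ C.) -/

import Mathlib

universe u
open FirstOrder

/-- The ZF universe as a structure in the language of a single binary relation
(membership). -/
def zfStructure : Language.graph.Structure ZFSet.{u} where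
  RelMap | .adj => fun x => x 0 ∈ x 1

/-- Any class `N` of sets, as a structure in the language of membership. -/
def classStructure (N : Set ZFSet.{u}) : Language.graph.Structure N where
  RelMap | .adj => fun x => (x 0 : ZFSet.{u}) ∈ (x 1 : ZFSet.{u})

attribute [local instance] zfStructure classStructure

/-- An elementary embedding of the ZF universe `V` into a class `N`: `j` maps into
`N` and preserves all first-order formulas of the language of membership. -/
structure ElemEmbInto (N : Set ZFSet.{u}) where
  toFun : ZFSet.{u} → ZFSet.{u}
  mem : ∀ x : ZFSet.{u}, toFun x ∈ N
  elem : ∀ (n : ℕ) (φ : Language.graph.Formula (Fin n)) (v : Fin n → ZFSet.{u}),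
    φ.Realize v ↔ φ.Realize (fun i => (⟨toFun (v i), mem (v i)⟩ : N))

/-- A (von Neumann) ordinal: a transitive set of transitive sets. -/
def IsOrd (x : ZFSet.{u}) : Prop :=
  x.IsTransitive ∧ ∀ y ∈ x, ZFSet.IsTransitive y

/-- A transitive class. -/
def TransClass (N : Set ZFSet.{u}) : Prop :=
  ∀ x ∈ N, ∀ y ∈ x, y ∈ N

namespace Superstrong

/-- A property of finite tuples, stated uniformly for all structures in the language of a binary
relation, that is defined by a single first-order formula. -/
def FODef {n : ℕ}
    (P : ∀ (X : Type (u + 1)) [Language.graph.Structure X], (Fin n → X) → Prop) : Prop :=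
  ∃ φ : Language.graph.Formula (Fin n), ∀ (X : Type (u + 1)) [Language.graph.Structure X]
    (v : Fin n → X), φ.Realize v ↔ P X v

/-- The membership relation of a structure. -/
def Mm {X : Type (u + 1)} [Language.graph.Structure X] (a b : X) : Prop :=
  Language.Structure.RelMap Language.adj ![a, b]

section FODef

variable {n : ℕ} {P Q : ∀ (X : Type (u + 1)) [Language.graph.Structure X], (Fin n → X) → Prop}

theorem FODef.mem (a b : Fin n) : FODef.{u} (fun X _ (v : Fin n → X) => Mm (v a) (v b)) :=
  ⟨Language.Relations.formula₂ Language.adj (.var a) (.var b), fun X _ v => by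
    simp [Mm]⟩

theorem FODef.eq (a b : Fin n) : FODef.{u} (fun X _ (v : Fin n → X) => v a = v b) :=
  ⟨Language.Term.equal (.var a) (.var b), fun X _ v => by simp⟩

theorem FODef.not (hP : FODef P) : FODef (fun X _ v => ¬ P X v) := by
  obtain ⟨φ, hφ⟩ := hP
  exact ⟨φ.not, fun X _ v => by simp [hφ]⟩

theorem FODef.imp (hP : FODef P) (hQ : FODef Q) : FODef (fun X _ v => P X v → Q X v) := by
  obtain ⟨φ, hφ⟩ := hP
  obtain ⟨ψ, hψ⟩ := hQ
  exact ⟨φ.imp ψ, fun X _ v => by simp [hφ, hψ]⟩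

theorem FODef.and (hP : FODef P) (hQ : FODef Q) : FODef (fun X _ v => P X v ∧ Q X v) := by
  obtain ⟨φ, hφ⟩ := hP
  obtain ⟨ψ, hψ⟩ := hQ
  exact ⟨φ ⊓ ψ, fun X _ v => by simp [hφ, hψ]⟩

theorem FODef.or (hP : FODef P) (hQ : FODef Q) : FODef (fun X _ v => P X v ∨ Q X v) := by
  obtain ⟨φ, hφ⟩ := hP
  obtain ⟨ψ, hψ⟩ := hQ
  exact ⟨φ ⊔ ψ, fun X _ v => by simp [hφ, hψ]⟩

theorem FODef.iff (hP : FODef P) (hQ : FODef Q) : FODef (fun X _ v => P X v ↔ Q X v) := by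
  obtain ⟨φ, hφ⟩ := hP
  obtain ⟨ψ, hψ⟩ := hQ
  exact ⟨φ.iff ψ, fun X _ v => by simp [hφ, hψ]⟩

theorem FODef.all
    {P : ∀ (X : Type (u + 1)) [Language.graph.Structure X], (Fin n → X) → X → Prop}
    (h : FODef (fun X _ (w : Fin (n + 1) → X) =>
      P X (fun i => w i.castSucc) (w (Fin.last n)))) :
    FODef (fun X _ v => ∀ x : X, P X v x) := by
  obtain ⟨φ, hφ⟩ := h
  refine ⟨(φ.relabel (Fin.lastCases (Sum.inr ()) Sum.inl : Fin (n + 1) → Fin n ⊕ Unit)).iAlls Unit,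
    fun X _ v => ?_⟩
  rw [Language.Formula.realize_iAlls]
  simp only [Language.Formula.realize_relabel, hφ, Function.comp_def]
  simp only [Fin.lastCases_castSucc, Fin.lastCases_last, Sum.elim_inl, Sum.elim_inr]
  exact ⟨fun h x => h (fun _ => x), fun h i => h (i ())⟩

theorem FODef.ex
    {P : ∀ (X : Type (u + 1)) [Language.graph.Structure X], (Fin n → X) → X → Prop}
    (h : FODef (fun X _ (w : Fin (n + 1) → X) =>
      P X (fun i => w i.castSucc) (w (Fin.last n)))) :
    FODef (fun X _ v => ∃ x : X, P X v x) := by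
  obtain ⟨φ, hφ⟩ := h
  refine ⟨(φ.relabel (Fin.lastCases (Sum.inr ()) Sum.inl : Fin (n + 1) → Fin n ⊕ Unit)).iExs Unit,
    fun X _ v => ?_⟩
  rw [Language.Formula.realize_iExs]
  simp only [Language.Formula.realize_relabel, hφ, Function.comp_def]
  simp only [Fin.lastCases_castSucc, Fin.lastCases_last, Sum.elim_inl, Sum.elim_inr]
  exact ⟨fun ⟨i, h⟩ => ⟨_, h⟩, fun ⟨x, h⟩ => ⟨fun _ => x, h⟩⟩

end FODef

section Language

variable {X : Type (u + 1)} [Language.graph.Structure X]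

/-- `p` is the Kuratowski pair of `a` and `b`. -/
def IsPr (p a b : X) : Prop :=
  ∃ s t : X, (∀ z, Mm z p ↔ z = s ∨ z = t) ∧ (∀ z, Mm z s ↔ z = a) ∧ ∀ z, Mm z t ↔ z = a ∨ z = b

/-- The pair of `a` and `b` belongs to `r`. -/
def PrMem (r a b : X) : Prop := ∃ p, IsPr p a b ∧ Mm p r

/-- The triple `(a, (b, c))` belongs to `r`. -/
def TrMem (r a b c : X) : Prop := ∃ p, IsPr p b c ∧ PrMem r a p

end Language

theorem FODef.isPr {n : ℕ} (a b c : Fin n) :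
    FODef.{u} (fun X _ (v : Fin n → X) => IsPr (v a) (v b) (v c)) := by
  unfold IsPr
  repeat' first
    | exact FODef.mem _ _ | exact FODef.eq _ _ | apply FODef.ex | apply FODef.all
    | apply FODef.and | apply FODef.or | apply FODef.iff

theorem FODef.prMem {n : ℕ} (a b c : Fin n) :
    FODef.{u} (fun X _ (v : Fin n → X) => PrMem (v a) (v b) (v c)) :=
  .ex (.and (.isPr _ _ _) (.mem _ _))

theorem FODef.trMem {n : ℕ} (a b c d : Fin n) :
    FODef.{u} (fun X _ (v : Fin n → X) => TrMem (v a) (v b) (v c) (v d)) :=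
  .ex (.and (.isPr _ _ _) (.prMem _ _ _))


/-- `val` identifies the structure `X` with a transitive class of sets. -/
structure IsSetModel {X : Type (u + 1)} [Language.graph.Structure X] (val : X → ZFSet.{u}) :
    Prop where
  inj : Function.Injective val
  mem_iff : ∀ a b : X, Mm a b ↔ val a ∈ val b
  trans : ∀ a : X, ∀ y ∈ val a, ∃ b, val b = y

section IsSetModel

variable {X : Type (u + 1)} [Language.graph.Structure X] {val : X → ZFSet.{u}}

theorem IsSetModel.isPr_iff (h : IsSetModel val) (p a b : X) :
    IsPr p a b ↔ val p = ZFSet.pair (val a) (val b) := by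
  unfold IsPr
  simp only [h.mem_iff]
  constructor
  · rintro ⟨s, t, hp, hs, ht⟩
    have e1 : val s = {val a} := by
      ext w
      constructor
      · intro hw
        obtain ⟨z, rfl⟩ := h.trans _ _ hw
        simp [(hs z).1 hw]
      · intro hw
        rw [ZFSet.mem_singleton] at hw
        exact hw ▸ (hs a).2 rfl
    have e2 : val t = {val a, val b} := by
      ext w
      constructor
      · intro hw
        obtain ⟨z, rfl⟩ := h.trans _ _ hw
        rcases (ht z).1 hw with rfl | rfl <;> simp
      · intro hw
        rw [ZFSet.mem_pair] at hw
        rcases hw with rfl | rfl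
        · exact (ht a).2 (Or.inl rfl)
        · exact (ht b).2 (Or.inr rfl)
    ext w
    rw [ZFSet.pair, ZFSet.mem_pair, ← e1, ← e2]
    constructor
    · intro hw
      obtain ⟨z, rfl⟩ := h.trans _ _ hw
      rcases (hp z).1 hw with rfl | rfl <;> simp
    · rintro (rfl | rfl)
      · exact (hp s).2 (Or.inl rfl)
      · exact (hp t).2 (Or.inr rfl)
  · intro hp
    rw [ZFSet.pair] at hp
    obtain ⟨s, hs⟩ := h.trans p {val a} (by rw [hp]; simp)
    obtain ⟨t, ht⟩ := h.trans p {val a, val b} (by rw [hp]; simp)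
    refine ⟨s, t, fun z => ?_, fun z => ?_, fun z => ?_⟩
    · rw [hp, ZFSet.mem_pair, ← hs, ← ht, h.inj.eq_iff, h.inj.eq_iff]
    · rw [hs, ZFSet.mem_singleton, h.inj.eq_iff]
    · rw [ht, ZFSet.mem_pair, h.inj.eq_iff, h.inj.eq_iff]

theorem IsSetModel.exists_fst_snd (h : IsSetModel val) {r : X} {x y : ZFSet.{u}}
    (hr : ZFSet.pair x y ∈ val r) : ∃ p a b : X, val p = ZFSet.pair x y ∧ val a = x ∧ val b = y := by
  obtain ⟨p, hp⟩ := h.trans r _ hr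
  obtain ⟨s, hs⟩ := h.trans p {x, y} (by rw [hp, ZFSet.pair]; simp)
  obtain ⟨a, ha⟩ := h.trans s x (by rw [hs]; simp)
  obtain ⟨b, hb⟩ := h.trans s y (by rw [hs]; simp)
  exact ⟨p, a, b, hp, ha, hb⟩

theorem IsSetModel.prMem_iff (h : IsSetModel val) (r a b : X) :
    PrMem r a b ↔ ZFSet.pair (val a) (val b) ∈ val r := by
  unfold PrMem
  simp only [h.mem_iff, h.isPr_iff]
  constructor
  · rintro ⟨p, hp, hr⟩
    rwa [← hp]
  · intro hr
    obtain ⟨p, hp⟩ := h.trans r _ hr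
    exact ⟨p, hp, hp ▸ hr⟩

theorem IsSetModel.trMem_iff (h : IsSetModel val) (r a b c : X) :
    TrMem r a b c ↔ ZFSet.pair (val a) (ZFSet.pair (val b) (val c)) ∈ val r := by
  unfold TrMem
  simp only [h.prMem_iff, h.isPr_iff]
  constructor
  · rintro ⟨p, hp, hr⟩
    rwa [← hp]
  · intro hr
    obtain ⟨_, _, p, -, -, hp⟩ := h.exists_fst_snd hr
    exact ⟨p, hp, hp ▸ hr⟩

theorem isSetModel_id : IsSetModel (id : ZFSet.{u} → ZFSet.{u}) where
  inj := Function.injective_id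
  mem_iff _ _ := Iff.rfl
  trans _ y _ := ⟨y, rfl⟩

theorem isSetModel_val {M : Set ZFSet.{u}} (hM : TransClass M) :
    IsSetModel (Subtype.val : M → ZFSet.{u}) where
  inj := Subtype.val_injective
  mem_iff _ _ := Iff.rfl
  trans a y hy := ⟨⟨y, hM a a.2 y hy⟩, rfl⟩

end IsSetModel

theorem mm_iff (a b : ZFSet.{u}) : Mm a b ↔ a ∈ b := Iff.rfl

theorem isPr_iff (p a b : ZFSet.{u}) : IsPr p a b ↔ p = ZFSet.pair a b :=
  isSetModel_id.isPr_iff p a b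

theorem prMem_iff (r a b : ZFSet.{u}) : PrMem r a b ↔ ZFSet.pair a b ∈ r :=
  isSetModel_id.prMem_iff r a b

theorem trMem_iff (r a b c : ZFSet.{u}) :
    TrMem r a b c ↔ ZFSet.pair a (ZFSet.pair b c) ∈ r :=
  isSetModel_id.trMem_iff r a b c

section Transfer

variable {M : Set ZFSet.{u}} (j : ElemEmbInto M)

theorem transfer₁ (P : ∀ (X : Type (u + 1)) [Language.graph.Structure X], X → Prop)
    (hP : FODef (n := 1) fun X _ v => P X (v 0)) (a : ZFSet.{u}) :
    P ZFSet.{u} a ↔ P M ⟨j.toFun a, j.mem a⟩ := by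
  obtain ⟨φ, hφ⟩ := hP
  have := j.elem _ φ ![a]
  rwa [hφ, hφ] at this

theorem transfer₂ (P : ∀ (X : Type (u + 1)) [Language.graph.Structure X], X → X → Prop)
    (hP : FODef (n := 2) fun X _ v => P X (v 0) (v 1)) (a b : ZFSet.{u}) :
    P ZFSet.{u} a b ↔ P M ⟨j.toFun a, j.mem a⟩ ⟨j.toFun b, j.mem b⟩ := by
  obtain ⟨φ, hφ⟩ := hP
  have := j.elem _ φ ![a, b]
  rwa [hφ, hφ] at this

theorem transfer₃ (P : ∀ (X : Type (u + 1)) [Language.graph.Structure X], X → X → X → Prop)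
    (hP : FODef (n := 3) fun X _ v => P X (v 0) (v 1) (v 2)) (a b c : ZFSet.{u}) :
    P ZFSet.{u} a b c ↔
      P M ⟨j.toFun a, j.mem a⟩ ⟨j.toFun b, j.mem b⟩ ⟨j.toFun c, j.mem c⟩ := by
  obtain ⟨φ, hφ⟩ := hP
  have := j.elem _ φ ![a, b, c]
  rwa [hφ, hφ] at this

theorem transfer₄ (P : ∀ (X : Type (u + 1)) [Language.graph.Structure X], X → X → X → X → Prop)
    (hP : FODef (n := 4) fun X _ v => P X (v 0) (v 1) (v 2) (v 3)) (a b c d : ZFSet.{u}) :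
    P ZFSet.{u} a b c d ↔
      P M ⟨j.toFun a, j.mem a⟩ ⟨j.toFun b, j.mem b⟩ ⟨j.toFun c, j.mem c⟩
        ⟨j.toFun d, j.mem d⟩ := by
  obtain ⟨φ, hφ⟩ := hP
  have := j.elem _ φ ![a, b, c, d]
  rwa [hφ, hφ] at this

end Transfer

section Reflection

variable {X : Type (u + 1)} [Language.graph.Structure X]

/-- `x` is a subset of `y`. -/
def Incl (x y : X) : Prop := ∀ z, Mm z x → Mm z y

/-- `x` is a transitive set. -/
def TransSet (x : X) : Prop := ∀ y, Mm y x → Incl y x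

/-- `E` assigns to each seed in `T` an ultrafilter on `I`. -/
def SeedUltra (E I T : X) : Prop :=
  (∀ c, Mm c T → PrMem E c I) ∧
    ∀ c, Mm c T → ∀ Y, Incl Y I → PrMem E c Y ∨ ∃ Z, PrMem E c Z ∧ ∀ z, Mm z Y → ¬ Mm z Z

/-- Every countable part of `E` is realized by a function which is coherent for the
pairing functions `q` on `I` and `q'` on seeds. -/
def SeedFIP (E q q' ω : X) : Prop :=
  ∀ g, (∀ n c Y, TrMem g n c Y → Mm n ω ∧ PrMem E c Y) →
    (∀ n c Y c' Y', TrMem g n c Y → TrMem g n c' Y' → c = c' ∧ Y = Y') →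
    ∃ h, (∀ n c Y, TrMem g n c Y → ∃ x, Mm x Y ∧ PrMem h c x) ∧
      (∀ c x x', PrMem h c x → PrMem h c x' → x = x') ∧
      ∀ c x a y b z, PrMem h c x → PrMem h a y → PrMem h b z → TrMem q' c a b → TrMem q x y z

/-- `q'` pairs seeds, and `q` is the converse of a pairing function. -/
def SeedPairing (q q' T : X) : Prop :=
  (∀ a, Mm a T → ∀ b, Mm b T → ∃ c, Mm c T ∧ TrMem q' c a b) ∧
    ∀ p x y x' y', TrMem q p x y → TrMem q p x' y' → x = x' ∧ y = y'

/-- A function into `I`, defined almost everywhere for a seed, is represented by a seed. -/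
def SeedClosed (E q q' I T : X) : Prop :=
  ∀ f, ∀ b, Mm b T → ∀ Y, PrMem E b Y → (∀ x, Mm x Y → ∃ y, Mm y I ∧ PrMem f x y) →
    ∃ c, Mm c T ∧ ∃ e Z, TrMem q' e b c ∧ PrMem E e Z ∧
      ∀ p, Mm p Z → ∃ x y, TrMem q p x y ∧ PrMem f x y

/-- Membership between seeds is decided by the ultrafilter of their pair. -/
def SeedMem (E q q' T : X) : Prop :=
  ∀ c, Mm c T → ∀ c', Mm c' T → ∀ e, TrMem q' e c' c →
    (Mm c' c → ∃ Z, PrMem E e Z ∧ ∀ p, Mm p Z → ∀ x y, TrMem q p x y → Mm x y) ∧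
    (¬ Mm c' c → ∃ Z, PrMem E e Z ∧ ∀ p, Mm p Z → ∀ x y, TrMem q p x y → ¬ Mm x y)

/-- The seeds in `S` that belong to the image of `x` are those in `y`. -/
def SeedAbs (E S x y : X) : Prop :=
  ∀ t, Mm t S →
    (Mm t y → ∃ Z, PrMem E t Z ∧ ∀ z, Mm z Z → Mm z x) ∧
    (¬ Mm t y → ∃ Z, PrMem E t Z ∧ ∀ z, Mm z Z → ¬ Mm z x)

/-- The domain `W` is large: it is transitive, closed under power sets, and it contains
the rank-initial segment determined by `κ`, where `L` is the relation "rank at most". -/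
def BigDomain (κ L W I T κ' K : X) : Prop :=
  Mm κ κ' ∧ Incl κ' T ∧ Incl κ I ∧ (∀ x l, Mm l κ → PrMem L x l → Mm x K) ∧ Mm K W ∧
    TransSet W ∧ Incl W I ∧ (∀ x, Mm x W → ∃ y, Mm y W ∧ ∀ z, Incl z x → Mm z y) ∧
    TransSet I ∧ TransSet T

/-- The seeds compute `κ`, the elements of `κ`, the set `A` and the elements of `W` correctly. -/
def SeedCorrect (κ A W T E κ' σ : X) : Prop :=
  SeedAbs E T κ κ' ∧ (∀ x, Mm x κ → SeedAbs E T x x) ∧ SeedAbs E κ' A A ∧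
    (∀ x, Mm x W → ∃ c, Mm c σ ∧ SeedAbs E T x c) ∧
    (∀ c, Mm c σ → ∃ x, Mm x W ∧ SeedAbs E T x c) ∧ Mm σ T

/-- A first-order statement implying that `κ` is superstrong for `A`. -/
def Reflected (C A L ω : X) : Prop :=
  ∃ κ W I T E q q' κ' σ K : X, Mm κ C ∧ BigDomain κ L W I T κ' K ∧ SeedUltra E I T ∧
    SeedFIP E q q' ω ∧ SeedPairing q q' T ∧ SeedClosed E q q' I T ∧ SeedMem E q q' T ∧
    SeedCorrect κ A W T E κ' σ

end Reflection

theorem FODef.incl {n : ℕ} (a b : Fin n) :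
    FODef.{u} (fun X _ (v : Fin n → X) => Incl (v a) (v b)) :=
  .all (.imp (.mem _ _) (.mem _ _))

theorem FODef.transSet {n : ℕ} (a : Fin n) :
    FODef.{u} (fun X _ (v : Fin n → X) => TransSet (v a)) :=
  .all (.imp (.mem _ _) (.incl _ _))

theorem FODef.seedAbs {n : ℕ} (a b c d : Fin n) :
    FODef.{u} (fun X _ (v : Fin n → X) => SeedAbs (v a) (v b) (v c) (v d)) := by
  unfold SeedAbs
  repeat' first
    | exact FODef.mem _ _ | exact FODef.eq _ _ | exact FODef.prMem _ _ _ | apply FODef.ex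
    | apply FODef.all | apply FODef.and | apply FODef.not | apply FODef.imp

theorem FODef.reflected :
    FODef.{u} (fun X _ (v : Fin 4 → X) => Reflected (v 0) (v 1) (v 2) (v 3)) := by
  unfold Reflected BigDomain SeedUltra SeedFIP SeedPairing SeedClosed SeedMem SeedCorrect
  repeat' first
    | exact FODef.mem _ _ | exact FODef.eq _ _ | exact FODef.prMem _ _ _
    | exact FODef.trMem _ _ _ _ | exact FODef.incl _ _ | exact FODef.transSet _
    | exact FODef.seedAbs _ _ _ _ | apply FODef.ex | apply FODef.all | apply FODef.and
    | apply FODef.or | apply FODef.not | apply FODef.imp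

/-- A class `S` of functions on which the ultrapower by `U` can be formed and collapsed. -/
structure UltraClass {Ω : Type (u + 1)} (U : Ultrafilter Ω) (S : Set (Ω → ZFSet.{u})) : Prop where
  const_mem : ∀ x, (fun _ => x) ∈ S
  comp_mem : ∀ p ∈ S, ∀ F : ZFSet.{u} → ZFSet.{u}, (fun ω => F (p ω)) ∈ S
  exists_pair : ∀ p ∈ S, ∀ q ∈ S, ∃ r ∈ S, ∃ F G : ZFSet.{u} → ZFSet.{u},
    ∀ᶠ ω in U, p ω = F (r ω) ∧ q ω = G (r ω)
  wf : ∀ p : ℕ → Ω → ZFSet.{u}, (∀ n, p n ∈ S) → ¬ ∀ n, ∀ᶠ ω in U, p (n + 1) ω ∈ p n ω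
  small : ∀ p ∈ S, ∃ R ⊆ S, Small.{u} R ∧
    ∀ q ∈ S, (∀ᶠ ω in U, q ω ∈ p ω) → ∃ r ∈ R, ∀ᶠ ω in U, q ω = r ω

namespace UltraClass

variable {Ω : Type (u + 1)} {U : Ultrafilter Ω} {S : Set (Ω → ZFSet.{u})}

theorem wellFounded (h : UltraClass U S) :
    WellFounded fun p q : S => ∀ᶠ ω in U, p.1 ω ∈ q.1 ω := by
  rw [wellFounded_iff_isEmpty_descending_chain]
  exact ⟨fun ⟨f, hf⟩ => h.wf (fun n => (f n).1) (fun n => (f n).2) hf⟩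

/-- Representatives of the elements of `p`. -/
def reps (h : UltraClass U S) (p : S) : Set (Ω → ZFSet.{u}) := (h.small p.1 p.2).choose

theorem reps_subset (h : UltraClass U S) (p : S) : h.reps p ⊆ S := (h.small p.1 p.2).choose_spec.1

instance (h : UltraClass U S) (p : S) : Small.{u} (h.reps p) := (h.small p.1 p.2).choose_spec.2.1

theorem exists_reps (h : UltraClass U S) (p q : S) (hq : ∀ᶠ ω in U, q.1 ω ∈ p.1 ω) :
    ∃ r : S, r.1 ∈ h.reps p ∧ ∀ᶠ ω in U, q.1 ω = r.1 ω := by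
  obtain ⟨r, hr, h'⟩ := (h.small p.1 p.2).choose_spec.2.2 q.1 q.2 hq
  exact ⟨⟨r, h.reps_subset p hr⟩, hr, h'⟩

/-- The elements of `reps p` which almost everywhere belong to `p`. -/
abbrev MemReps (h : UltraClass U S) (p : S) : Type (u + 1) :=
  {r : h.reps p // ∀ᶠ ω in U, r.1 ω ∈ p.1 ω}

/-- The Mostowski collapse of the ultrapower. -/
noncomputable def collapse (h : UltraClass U S) : S → ZFSet.{u} :=
  h.wellFounded.fix fun p rec => ZFSet.range fun r : h.MemReps p =>
    rec ⟨r.1.1, h.reps_subset p r.1.2⟩ r.2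

theorem mem_collapse_aux (h : UltraClass U S) (p : S) (z : ZFSet.{u}) :
    z ∈ h.collapse p ↔ ∃ r : S, r.1 ∈ h.reps p ∧ (∀ᶠ ω in U, r.1 ω ∈ p.1 ω) ∧
      h.collapse r = z := by
  rw [collapse, h.wellFounded.fix_eq, ZFSet.mem_range]
  constructor
  · rintro ⟨r, rfl⟩
    exact ⟨⟨r.1.1, h.reps_subset p r.1.2⟩, r.1.2, r.2, rfl⟩
  · rintro ⟨r, hr, hrp, rfl⟩
    exact ⟨⟨⟨r.1, hr⟩, hrp⟩, rfl⟩

theorem collapse_congr (h : UltraClass U S) (p : S) :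
    ∀ p' : S, (∀ᶠ ω in U, p.1 ω = p'.1 ω) → h.collapse p = h.collapse p' := by
  induction p using h.wellFounded.induction with | _ p ih
  intro p' hp
  ext z
  rw [mem_collapse_aux, mem_collapse_aux]
  constructor
  · rintro ⟨r, -, hrp, rfl⟩
    have hrp' : ∀ᶠ ω in U, r.1 ω ∈ p'.1 ω := by
      filter_upwards [hp, hrp] with ω h1 h2
      rwa [← h1]
    obtain ⟨r', hr', he⟩ := h.exists_reps p' r hrp'
    refine ⟨r', hr', ?_, (ih r hrp r' he).symm⟩
    filter_upwards [he, hrp'] with ω h1 h2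
    rwa [← h1]
  · rintro ⟨r, -, hrp', rfl⟩
    have hrp : ∀ᶠ ω in U, r.1 ω ∈ p.1 ω := by
      filter_upwards [hp, hrp'] with ω h1 h2
      rwa [h1]
    obtain ⟨r', hr', he⟩ := h.exists_reps p r hrp
    have hrp2 : ∀ᶠ ω in U, r'.1 ω ∈ p.1 ω := by
      filter_upwards [he, hrp] with ω h1 h2
      rwa [← h1]
    exact ⟨r', hr', hrp2, ih r' hrp2 r (by filter_upwards [he] with ω h1 using h1.symm)⟩

theorem mem_collapse (h : UltraClass U S) (p : S) (z : ZFSet.{u}) :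
    z ∈ h.collapse p ↔ ∃ q : S, (∀ᶠ ω in U, q.1 ω ∈ p.1 ω) ∧ h.collapse q = z := by
  rw [mem_collapse_aux]
  constructor
  · rintro ⟨r, -, h1, h2⟩
    exact ⟨r, h1, h2⟩
  · rintro ⟨q, hq, rfl⟩
    obtain ⟨r, hr, he⟩ := h.exists_reps p q hq
    refine ⟨r, hr, ?_, (h.collapse_congr q r he).symm⟩
    filter_upwards [he, hq] with ω h1 h2
    rwa [← h1]

theorem exists_skolem (h : UltraClass U S) {ι : Type*} [Finite ι] (p : ι → S) :
    ∃ r ∈ S, ∃ G : ι → ZFSet.{u} → ZFSet.{u}, ∀ᶠ ω in U, ∀ i, (p i).1 ω = G i (r ω) := by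
  revert p
  refine Finite.induction_empty_option
    (P := fun ι => ∀ p : ι → S, ∃ r ∈ S, ∃ G : ι → ZFSet.{u} → ZFSet.{u},
      ∀ᶠ ω in U, ∀ i, (p i).1 ω = G i (r ω)) ?_ ?_ ?_ ι
  · intro α β e ih p
    obtain ⟨r, hr, G, hG⟩ := ih (p ∘ e)
    refine ⟨r, hr, G ∘ e.symm, ?_⟩
    filter_upwards [hG] with ω hω i
    simpa using hω (e.symm i)
  · intro p
    exact ⟨_, h.const_mem ∅, fun i => i.elim, by simp⟩
  · intro α _ ih p
    obtain ⟨r, hr, G, hG⟩ := ih (fun i => p (some i))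
    obtain ⟨r', hr', F, F', hF⟩ := h.exists_pair r hr (p none).1 (p none).2
    refine ⟨r', hr', fun i => i.elim F' (fun a x => G a (F x)), ?_⟩
    filter_upwards [hG, hF] with ω h1 h2 i
    cases i with
    | none => exact h2.2
    | some a => simp [h1 a, h2.1]

theorem exists_choice (h : UltraClass U S) {ι : Type*} [Finite ι] (p : ι → S)
    (P : (ι → ZFSet.{u}) → ZFSet.{u} → Prop)
    (hP : ∀ᶠ ω in U, ∃ x, P (fun i => (p i).1 ω) x) :
    ∃ q : S, ∀ᶠ ω in U, P (fun i => (p i).1 ω) (q.1 ω) := by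
  classical
  obtain ⟨r, hr, G, hG⟩ := h.exists_skolem p
  refine ⟨⟨_, h.comp_mem r hr fun y => Classical.epsilon (P fun i => G i y)⟩, ?_⟩
  filter_upwards [hP, hG] with ω h1 h2
  have e : (fun i => (p i).1 ω) = fun i => G i (r ω) := funext h2
  rw [e] at h1 ⊢
  exact Classical.epsilon_spec h1

theorem collapse_inj (h : UltraClass U S) (p : S) :
    ∀ p' : S, h.collapse p = h.collapse p' → ∀ᶠ ω in U, p.1 ω = p'.1 ω := by
  induction p using h.wellFounded.induction with | _ p ih
  intro p' hp
  by_contra hne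
  rw [← Ultrafilter.eventually_not] at hne
  obtain ⟨q, hq⟩ := h.exists_choice ![p, p'] (fun v x => ¬ (x ∈ v 0 ↔ x ∈ v 1)) (by
    filter_upwards [hne] with ω hω
    by_contra hcon
    push Not at hcon
    exact hω (ZFSet.ext hcon))
  have hq' : ∀ᶠ ω in U, (q.1 ω ∈ p.1 ω ∧ q.1 ω ∉ p'.1 ω) ∨ (q.1 ω ∈ p'.1 ω ∧ q.1 ω ∉ p.1 ω) := by
    filter_upwards [hq] with ω hω
    simp only [Matrix.cons_val_zero, Matrix.cons_val_one] at hω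
    tauto
  rw [Ultrafilter.eventually_or] at hq'
  have key : ∀ᶠ _ in (U : Filter Ω), False := by
    rcases hq' with hq' | hq'
    · have h1 : h.collapse q ∈ h.collapse p' := by
        rw [← hp]
        exact (h.mem_collapse _ _).2 ⟨q, hq'.mono fun ω hω => hω.1, rfl⟩
      obtain ⟨q', hqq, he⟩ := (h.mem_collapse _ _).1 h1
      filter_upwards [ih q (hq'.mono fun ω hω => hω.1) q' he.symm, hq', hqq] with ω h1 h2 h3
      exact h2.2 (h1 ▸ h3)
    · have h1 : h.collapse q ∈ h.collapse p := by
        rw [hp]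
        exact (h.mem_collapse _ _).2 ⟨q, hq'.mono fun ω hω => hω.1, rfl⟩
      obtain ⟨q', hqq, he⟩ := (h.mem_collapse _ _).1 h1
      filter_upwards [ih q' hqq q he, hq', hqq] with ω h1 h2 h3
      exact h2.2 (h1 ▸ h3)
  exact key.exists.elim fun _ h => h

theorem collapse_mem_iff (h : UltraClass U S) (q p : S) :
    h.collapse q ∈ h.collapse p ↔ ∀ᶠ ω in U, q.1 ω ∈ p.1 ω := by
  refine ⟨fun hq => ?_, fun hq => (h.mem_collapse _ _).2 ⟨q, hq, rfl⟩⟩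
  obtain ⟨q', h1, h2⟩ := (h.mem_collapse _ _).1 hq
  filter_upwards [h1, h.collapse_inj q' q h2] with ω h3 h4
  rwa [← h4]

theorem collapse_eq_iff (h : UltraClass U S) (q p : S) :
    h.collapse q = h.collapse p ↔ ∀ᶠ ω in U, q.1 ω = p.1 ω :=
  ⟨h.collapse_inj q p, h.collapse_congr q p⟩

/-- The collapsed ultrapower. -/
def model (h : UltraClass U S) : Set ZFSet.{u} := Set.range h.collapse

theorem transClass_model (h : UltraClass U S) : TransClass h.model := by
  rintro _ ⟨p, rfl⟩ y hy
  obtain ⟨q, -, rfl⟩ := (h.mem_collapse _ _).1 hy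
  exact ⟨q, rfl⟩

/-- The collapse as a map into the collapsed ultrapower. -/
noncomputable def toModel (h : UltraClass U S) (p : S) : h.model := ⟨h.collapse p, p, rfl⟩

theorem exists_var {α : Type*} : ∀ t : Language.graph.Term α, ∃ a, t = .var a
  | .var a => ⟨a, rfl⟩
  | .func f _ => isEmptyElim f

theorem los (h : UltraClass U S) {α : Type*} [Finite α] {n : ℕ}
    (φ : Language.graph.BoundedFormula α n) (v : α → S) (xs : Fin n → S) :
    φ.Realize (fun a => h.toModel (v a)) (fun i => h.toModel (xs i)) ↔
      ∀ᶠ ω in U, φ.Realize (fun a => (v a).1 ω) (fun i => (xs i).1 ω) := by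
  have hel : ∀ {n : ℕ} (xs : Fin n → S) (a : α ⊕ Fin n),
      Sum.elim (fun a => h.toModel (v a)) (fun i => h.toModel (xs i)) a =
        h.toModel (Sum.elim v xs a) := by
    rintro n xs (a | a) <;> rfl
  have hel' : ∀ {n : ℕ} (xs : Fin n → S) (a : α ⊕ Fin n) (ω : Ω),
      Sum.elim (fun a => (v a).1 ω) (fun i => (xs i).1 ω) a = (Sum.elim v xs a).1 ω := by
    rintro n xs (a | a) ω <;> rfl
  induction φ with
  | falsum => simp [Language.BoundedFormula.Realize, U.neBot.ne]
  | equal t₁ t₂ =>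
    obtain ⟨a, rfl⟩ := exists_var t₁
    obtain ⟨b, rfl⟩ := exists_var t₂
    simp only [Language.BoundedFormula.Realize, Language.Term.realize_var, hel, hel']
    rw [← h.collapse_eq_iff]
    exact Subtype.ext_iff
  | rel R ts =>
    cases R
    obtain ⟨a, ha⟩ := exists_var (ts 0)
    obtain ⟨b, hb⟩ := exists_var (ts 1)
    simp only [Language.BoundedFormula.Realize]
    change ((Language.Term.realize _ (ts 0) : h.model) : ZFSet.{u}) ∈
      ((Language.Term.realize _ (ts 1) : h.model) : ZFSet.{u}) ↔
        ∀ᶠ ω in (U : Filter Ω), (Language.Term.realize _ (ts 0) : ZFSet.{u}) ∈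
          (Language.Term.realize _ (ts 1) : ZFSet.{u})
    simp only [ha, hb, Language.Term.realize_var, hel, hel']
    exact h.collapse_mem_iff _ _
  | imp φ ψ ih₁ ih₂ =>
    simp only [Language.BoundedFormula.realize_imp, ih₁, ih₂]
    rw [Ultrafilter.eventually_imp]
  | @all n φ ih =>
    have snoc : ∀ p : S, (Fin.snoc (fun i => h.toModel (xs i)) (h.toModel p) :
        Fin (n + 1) → h.model) = fun i => h.toModel ((Fin.snoc xs p : Fin (n + 1) → S) i) := by
      intro p
      funext i
      refine Fin.lastCases ?_ (fun i => ?_) i <;> simp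
    have snoc' : ∀ (p : S) ω, (Fin.snoc (fun i => (xs i).1 ω) (p.1 ω) :
        Fin (n + 1) → ZFSet.{u}) = fun i => ((Fin.snoc xs p : Fin (n + 1) → S) i).1 ω := by
      intro p ω
      funext i
      refine Fin.lastCases ?_ (fun i => ?_) i <;> simp
    simp only [Language.BoundedFormula.realize_all]
    constructor
    · intro hall
      by_contra hne
      rw [← Ultrafilter.eventually_not] at hne
      obtain ⟨q, hq⟩ := h.exists_choice (Sum.elim v xs)
        (fun w x => ¬ φ.Realize (fun a => w (.inl a)) (Fin.snoc (fun i => w (.inr i)) x))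
        (by
          filter_upwards [hne] with ω hω
          push Not at hω
          exact hω)
      have h1 := hall (h.toModel q)
      replace h1 := (ih _).1 (snoc q ▸ h1)
      have key : ∀ᶠ _ in (U : Filter Ω), False := by
        filter_upwards [h1, hq] with ω h2 h3
        rw [← snoc'] at h2
        exact h3 h2
      exact key.exists.elim fun _ h => h
    · rintro hall ⟨_, p, rfl⟩
      change φ.Realize _ (Fin.snoc _ (h.toModel p))
      rw [snoc]
      refine (ih _).2 ?_
      filter_upwards [hall] with ω hω
      rw [← snoc']
      exact hω _

/-- The elementary embedding into the collapsed ultrapower. -/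
noncomputable def embedding (h : UltraClass U S) : ElemEmbInto h.model where
  toFun x := h.collapse ⟨_, h.const_mem x⟩
  mem x := ⟨_, rfl⟩
  elem n φ v := by
    have h₁ := h.los φ (fun i => ⟨_, h.const_mem (v i)⟩) Fin.elim0
    rw [Filter.eventually_congr (q := fun _ => φ.Realize v) (.of_forall fun ω =>
      Iff.of_eq (congrArg (Language.BoundedFormula.Realize φ v) (Subsingleton.elim _ _))), Filter.eventually_const] at h₁
    exact h₁.symm.trans (Iff.of_eq (congrArg (Language.BoundedFormula.Realize φ _) (Subsingleton.elim _ _)))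

end UltraClass

/-- The functions realizing all requirements in `R`, coherently for `q` and `q'`. -/
def Realizers (q q' : ZFSet.{u}) (R : Set (ZFSet.{u} × ZFSet.{u})) :
    Set (ZFSet.{u} → ZFSet.{u}) :=
  {h | (∀ p ∈ R, h p.1 ∈ p.2) ∧ ∀ c ∈ Prod.fst '' R, ∀ a ∈ Prod.fst '' R, ∀ b ∈ Prod.fst '' R,
    ZFSet.pair c (ZFSet.pair a b) ∈ q' → ZFSet.pair (h c) (ZFSet.pair (h a) (h b)) ∈ q}

theorem Realizers.anti {q q' : ZFSet.{u}} {R R' : Set (ZFSet.{u} × ZFSet.{u})} (h : R ⊆ R') :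
    Realizers q q' R' ⊆ Realizers q q' R := fun _ hf =>
  ⟨fun p hp => hf.1 p (h hp), fun c hc a ha b hb =>
    hf.2 c (Set.image_mono h hc) a (Set.image_mono h ha) b (Set.image_mono h hb)⟩

/-- A countably complete system of ultrafilters on `I`, indexed by the seeds in `T`. -/
structure SeedSystem (E I T q q' : ZFSet.{u}) : Prop where
  nonempty : ∃ c, c ∈ T
  top : ∀ c ∈ T, ZFSet.pair c I ∈ E
  ultra : ∀ c ∈ T, ∀ Y, (∀ z ∈ Y, z ∈ I) →
    ZFSet.pair c Y ∈ E ∨ ∃ Z, ZFSet.pair c Z ∈ E ∧ ∀ z ∈ Y, z ∉ Z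
  fip : ∀ R : Set (ZFSet.{u} × ZFSet.{u}), R.Countable →
    (∀ p ∈ R, ZFSet.pair p.1 p.2 ∈ E) → (Realizers q q' R).Nonempty
  pairing : ∀ a ∈ T, ∀ b ∈ T, ∃ c ∈ T, ZFSet.pair c (ZFSet.pair a b) ∈ q'
  unpairing : ∀ p x y x' y', ZFSet.pair p (ZFSet.pair x y) ∈ q →
    ZFSet.pair p (ZFSet.pair x' y') ∈ q → x = x' ∧ y = y'
  closed : ∀ f : ZFSet.{u} → ZFSet.{u}, ∀ b ∈ T, ∀ Y, ZFSet.pair b Y ∈ E → (∀ x ∈ Y, f x ∈ I) →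
    ∃ c ∈ T, ∃ e Z, ZFSet.pair e (ZFSet.pair b c) ∈ q' ∧ ZFSet.pair e Z ∈ E ∧
      ∀ p ∈ Z, ∃ x, ZFSet.pair p (ZFSet.pair x (f x)) ∈ q
  mem : ∀ c ∈ T, ∀ c' ∈ T, ∀ e, ZFSet.pair e (ZFSet.pair c' c) ∈ q' →
    (c' ∈ c → ∃ Z, ZFSet.pair e Z ∈ E ∧ ∀ p ∈ Z, ∀ x y, ZFSet.pair p (ZFSet.pair x y) ∈ q → x ∈ y) ∧
    (c' ∉ c → ∃ Z, ZFSet.pair e Z ∈ E ∧ ∀ p ∈ Z, ∀ x y, ZFSet.pair p (ZFSet.pair x y) ∈ q → x ∉ y)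
  trans_left : ∀ x ∈ I, ∀ y ∈ x, y ∈ I
  trans_right : ∀ x ∈ T, ∀ y ∈ x, y ∈ T

namespace SeedSystem

variable {E I T q q' : ZFSet.{u}}

theorem exists_ultrafilter (s : SeedSystem E I T q q') :
    ∃ U : Ultrafilter (ZFSet.{u} → ZFSet.{u}), ∀ R : Set (ZFSet.{u} × ZFSet.{u}), R.Countable →
      (∀ p ∈ R, ZFSet.pair p.1 p.2 ∈ E) → Realizers q q' R ∈ U := by
  let G : Set (Set (ZFSet.{u} → ZFSet.{u})) := {t | ∃ R : Set (ZFSet.{u} × ZFSet.{u}),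
    R.Countable ∧ (∀ p ∈ R, ZFSet.pair p.1 p.2 ∈ E) ∧ Realizers q q' R = t}
  have : (Filter.generate G).NeBot := by
    rw [Filter.generate_neBot_iff]
    intro t ht hfin
    have ht' : ∀ x ∈ t, ∃ R : Set (ZFSet.{u} × ZFSet.{u}),
      R.Countable ∧ (∀ p ∈ R, ZFSet.pair p.1 p.2 ∈ E) ∧ Realizers q q' R = x := fun x hx => ht hx
    choose! R hR using ht'
    have hne := s.fip (⋃ x ∈ t, R x) (hfin.countable.biUnion fun x hx => (hR x hx).1) (by
      intro p hp
      simp only [Set.mem_iUnion] at hp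
      obtain ⟨x, hx, hp⟩ := hp
      exact (hR x hx).2.1 p hp)
    refine hne.mono fun f hf => Set.mem_sInter.2 fun x hx => ?_
    rw [← (hR x hx).2.2]
    exact Realizers.anti (Set.subset_biUnion_of_mem hx) hf
  refine ⟨Ultrafilter.of (Filter.generate G), fun R hR hE => ?_⟩
  exact Ultrafilter.of_le _ (Filter.mem_generate_of_mem ⟨R, hR, hE, rfl⟩)

/-- An ultrafilter realizing all requirements of a seed system. -/
noncomputable def ultrafilter (s : SeedSystem E I T q q') :
    Ultrafilter (ZFSet.{u} → ZFSet.{u}) := s.exists_ultrafilter.choose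

theorem realizers_mem (s : SeedSystem E I T q q') (R : Set (ZFSet.{u} × ZFSet.{u}))
    (hR : R.Countable) (hE : ∀ p ∈ R, ZFSet.pair p.1 p.2 ∈ E) :
    Realizers q q' R ∈ s.ultrafilter := s.exists_ultrafilter.choose_spec R hR hE

theorem eventually_mem (s : SeedSystem E I T q q') {c Z : ZFSet.{u}} (h : ZFSet.pair c Z ∈ E) :
    ∀ᶠ f : ZFSet.{u} → ZFSet.{u} in s.ultrafilter, f c ∈ Z := by
  filter_upwards [s.realizers_mem {(c, Z)} (Set.countable_singleton _) (by simpa)] with f hf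
  exact hf.1 (c, Z) rfl

theorem eventually_mem_top (s : SeedSystem E I T q q') {c : ZFSet.{u}} (h : c ∈ T) :
    ∀ᶠ f : ZFSet.{u} → ZFSet.{u} in s.ultrafilter, f c ∈ I := s.eventually_mem (s.top c h)

theorem eventually_pair (s : SeedSystem E I T q q') {c a b Z : ZFSet.{u}}
    (h : ZFSet.pair c (ZFSet.pair a b) ∈ q') (hc : ZFSet.pair c Z ∈ E) (ha : a ∈ T) (hb : b ∈ T) :
    ∀ᶠ f : ZFSet.{u} → ZFSet.{u} in s.ultrafilter, ZFSet.pair (f c) (ZFSet.pair (f a) (f b)) ∈ q := by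
  filter_upwards [s.realizers_mem {(c, Z), (a, I), (b, I)} (Set.toFinite _).countable (by
    rintro p (rfl | rfl | rfl)
    exacts [hc, s.top a ha, s.top b hb])] with f hf
  exact hf.2 c ⟨(c, Z), by simp⟩ a ⟨(a, I), by simp⟩ b ⟨(b, I), by simp⟩ h

theorem pair_mem_of_eventually (s : SeedSystem E I T q q') {c : ZFSet.{u}} (hc : c ∈ T)
    (P : ZFSet.{u} → Prop) (h : ∀ᶠ f : ZFSet.{u} → ZFSet.{u} in s.ultrafilter, P (f c)) :
    ZFSet.pair c (ZFSet.sep P I) ∈ E := by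
  refine (s.ultra c hc (ZFSet.sep P I) fun z hz => (ZFSet.mem_sep.1 hz).1).resolve_right ?_
  rintro ⟨Z, hZ, hd⟩
  obtain ⟨f, h1, h2, h3⟩ := (h.and ((s.eventually_mem hZ).and (s.eventually_mem_top hc))).exists
  exact hd _ (ZFSet.mem_sep.2 ⟨h3, h1⟩) h2

/-- The functions represented by seeds. -/
def Functions (T : ZFSet.{u}) : Set ((ZFSet.{u} → ZFSet.{u}) → ZFSet.{u}) :=
  {p | ∃ c ∈ T, ∃ f : ZFSet.{u} → ZFSet.{u}, p = fun h => f (h c)}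

theorem ultraClass (s : SeedSystem E I T q q') : UltraClass s.ultrafilter (Functions T) where
  const_mem x := by
    obtain ⟨c, hc⟩ := s.nonempty
    exact ⟨c, hc, fun _ => x, rfl⟩
  comp_mem := by
    rintro _ ⟨c, hc, f, rfl⟩ F
    exact ⟨c, hc, fun x => F (f x), rfl⟩
  exists_pair := by
    rintro _ ⟨a, ha, f, rfl⟩ _ ⟨b, hb, g, rfl⟩
    obtain ⟨c, hc, habc⟩ := s.pairing a ha b hb
    refine ⟨_, ⟨c, hc, fun x => x, rfl⟩,
      fun p => f (Classical.epsilon fun x => ∃ y, ZFSet.pair p (ZFSet.pair x y) ∈ q),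
      fun p => g (Classical.epsilon fun y => ∃ x, ZFSet.pair p (ZFSet.pair x y) ∈ q), ?_⟩
    filter_upwards [s.eventually_pair habc (s.top c hc) ha hb] with h hh
    obtain ⟨y, hy⟩ := Classical.epsilon_spec
      (p := fun x => ∃ y, ZFSet.pair (h c) (ZFSet.pair x y) ∈ q) ⟨_, _, hh⟩
    obtain ⟨x, hx⟩ := Classical.epsilon_spec
      (p := fun y => ∃ x, ZFSet.pair (h c) (ZFSet.pair x y) ∈ q) ⟨_, _, hh⟩
    exact ⟨congrArg f (s.unpairing _ _ _ _ _ hh hy).1, congrArg g (s.unpairing _ _ _ _ _ hh hx).2⟩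
  wf := by
    intro p hp hdesc
    choose c hc f hf using hp
    obtain rfl : p = fun n h => f n (h (c n)) := funext hf
    choose e he heq using fun n => s.pairing (c (n + 1)) (hc _) (c n) (hc n)
    let P : ℕ → ZFSet.{u} → Prop := fun n y =>
      ∃ a b, ZFSet.pair y (ZFSet.pair a b) ∈ q ∧ f (n + 1) a ∈ f n b
    have hE : ∀ n, ZFSet.pair (e n) (ZFSet.sep (P n) I) ∈ E := fun n => by
      refine s.pair_mem_of_eventually (he n) _ ?_
      filter_upwards [hdesc n, s.eventually_pair (heq n) (s.top _ (he n)) (hc _) (hc n)] with h h1 h2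
      exact ⟨_, _, h2, h1⟩
    obtain ⟨h, h1, h2⟩ := s.fip
      (Set.range (fun n => (e n, ZFSet.sep (P n) I)) ∪ Set.range fun n => (c n, I))
      ((Set.countable_range _).union (Set.countable_range _)) (by
        rintro _ (⟨n, rfl⟩ | ⟨n, rfl⟩)
        exacts [hE n, s.top _ (hc n)])
    have hcm : ∀ n, c n ∈ Prod.fst ''
        (Set.range (fun n => (e n, ZFSet.sep (P n) I)) ∪ Set.range fun n => (c n, I)) :=
      fun n => ⟨_, Or.inr ⟨n, rfl⟩, rfl⟩
    have key : ∀ n, f (n + 1) (h (c (n + 1))) ∈ f n (h (c n)) := fun n => by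
      have h3 := h2 (e n) ⟨_, Or.inl ⟨n, rfl⟩, rfl⟩ _ (hcm (n + 1)) _ (hcm n) (heq n)
      obtain ⟨a, b, hab, hf⟩ := (ZFSet.mem_sep.1 (h1 _ (Or.inl ⟨n, rfl⟩))).2
      obtain ⟨rfl, rfl⟩ := s.unpairing _ _ _ _ _ h3 hab
      exact hf
    exact (wellFounded_iff_isEmpty_descending_chain.1 ZFSet.mem_wf).elim
      ⟨fun n => f n (h (c n)), key⟩
  small := by
    classical
    rintro _ ⟨b, hb, g, rfl⟩
    let V : Set ZFSet.{u} := ⋃ x : {x // x ∈ I}, {y | y ∈ g x}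
    have : Small.{u} V := by
      have : Small.{u} {x // x ∈ I} := ZFSet.small_coe I
      have : ∀ x : {x // x ∈ I}, Small.{u} {y | y ∈ g x} := fun x => ZFSet.small_coe (g x)
      exact small_iUnion _
    have : Small.{u} {x // x ∈ I} := ZFSet.small_coe I
    have : Small.{u} {x // x ∈ T} := ZFSet.small_coe T
    let F : {x // x ∈ T} × ({x // x ∈ I} → Option V) → (ZFSet.{u} → ZFSet.{u}) → ZFSet.{u} :=
      fun r h => if hI : h r.1 ∈ I then ((r.2 ⟨_, hI⟩).elim ∅ Subtype.val) else ∅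
    refine ⟨Set.range F, ?_, ?_, ?_⟩
    · rintro _ ⟨⟨c, G⟩, rfl⟩
      exact ⟨c, c.2, fun y => if hI : y ∈ I then ((G ⟨_, hI⟩).elim ∅ Subtype.val) else ∅, rfl⟩
    · have : Small.{u} (Option V) := ⟨Option (Shrink V), ⟨(equivShrink V).optionCongr⟩⟩
      exact small_range F
    · rintro _ ⟨c, hc, f, rfl⟩ hlt
      refine ⟨_, ⟨⟨⟨c, hc⟩, fun x => if hx : f x ∈ V then some ⟨_, hx⟩ else none⟩, rfl⟩, ?_⟩
      filter_upwards [hlt, s.eventually_mem_top hb, s.eventually_mem_top hc] with h h1 h2 h3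
      have h4 : f (h c) ∈ V := Set.mem_iUnion.2 ⟨⟨_, h2⟩, h1⟩
      simp [F, h3, h4]

/-- The seed `c` as an element of the ultrapower. -/
def seed (c : ZFSet.{u}) (hc : c ∈ T) : Functions T := ⟨fun h => h c, c, hc, fun x => x, rfl⟩

theorem exists_seed (s : SeedSystem E I T q q') (p : Functions T)
    (hp : ∀ᶠ h : ZFSet.{u} → ZFSet.{u} in s.ultrafilter, p.1 h ∈ I) :
    ∃ c ∈ T, ∀ᶠ h : ZFSet.{u} → ZFSet.{u} in s.ultrafilter, p.1 h = h c := by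
  obtain ⟨_, b, hb, f, rfl⟩ := p
  obtain ⟨c, hc, e, Z, he, hZ, hf⟩ := s.closed f b hb _
    (s.pair_mem_of_eventually hb (fun x => f x ∈ I) hp) fun x hx => (ZFSet.mem_sep.1 hx).2
  refine ⟨c, hc, ?_⟩
  filter_upwards [s.eventually_mem hZ, s.eventually_pair he hZ hb hc] with h h1 h2
  obtain ⟨x, hx⟩ := hf _ h1
  obtain ⟨h3, h4⟩ := s.unpairing _ _ _ _ _ h2 hx
  rw [h4, ← h3]

theorem seed_mem_iff (s : SeedSystem E I T q q') {c c' : ZFSet.{u}} (hc : c ∈ T) (hc' : c' ∈ T) :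
    (∀ᶠ h : ZFSet.{u} → ZFSet.{u} in s.ultrafilter, h c' ∈ h c) ↔ c' ∈ c := by
  obtain ⟨e, he, hq⟩ := s.pairing c' hc' c hc
  have hm := s.mem c hc c' hc' e hq
  have hp := s.eventually_pair hq (s.top e he) hc' hc
  constructor
  · intro h
    by_contra hn
    obtain ⟨Z, hZ, hd⟩ := hm.2 hn
    obtain ⟨f, h1, h2, h3⟩ := (h.and ((s.eventually_mem hZ).and hp)).exists
    exact hd _ h2 _ _ h3 h1
  · intro h
    obtain ⟨Z, hZ, hd⟩ := hm.1 h
    filter_upwards [s.eventually_mem hZ, hp] with f h1 h2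
    exact hd _ h1 _ _ h2

theorem collapse_seed (s : SeedSystem E I T q q') (c : ZFSet.{u}) :
    ∀ hc : c ∈ T, s.ultraClass.collapse (seed c hc) = c := by
  induction c using ZFSet.inductionOn with | _ c ih
  intro hc
  ext z
  rw [UltraClass.mem_collapse]
  constructor
  · rintro ⟨p, hp, rfl⟩
    obtain ⟨c', hc', he⟩ := s.exists_seed p (by
      filter_upwards [hp, s.eventually_mem_top hc] with h h1 h2
      exact s.trans_left _ h2 _ h1)
    have hm : c' ∈ c := (s.seed_mem_iff hc hc').1 (by
      filter_upwards [hp, he] with h h1 h2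
      exact h2 ▸ h1)
    rw [s.ultraClass.collapse_congr p (seed c' hc') he, ih c' hm]
    exact hm
  · intro hz
    have hz' := s.trans_right c hc z hz
    exact ⟨seed z hz', (s.seed_mem_iff hc hz').2 hz, ih z hz hz'⟩

theorem exists_seed_of_mem (s : SeedSystem E I T q q') (p : Functions T) (x z : ZFSet.{u})
    (hx : ∀ y ∈ x, y ∈ I) (hz : z = s.ultraClass.collapse p) (hzx : z ∈ s.ultraClass.embedding.toFun x) :
    z ∈ T := by
  subst hz
  have h1 : ∀ᶠ h : ZFSet.{u} → ZFSet.{u} in s.ultrafilter, p.1 h ∈ x := (s.ultraClass.collapse_mem_iff p _).1 hzx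
  obtain ⟨c, hc, he⟩ := s.exists_seed p (h1.mono fun h hh => hx _ hh)
  rw [s.ultraClass.collapse_congr p (seed c hc) he, s.collapse_seed]
  exact hc

theorem mem_embedding_iff (s : SeedSystem E I T q q') {c x : ZFSet.{u}} (hc : c ∈ T) :
    c ∈ s.ultraClass.embedding.toFun x ↔ ∀ᶠ h : ZFSet.{u} → ZFSet.{u} in s.ultrafilter, h c ∈ x := by
  conv_lhs => rw [← s.collapse_seed c hc]
  exact s.ultraClass.collapse_mem_iff (seed c hc) _

theorem mem_embedding_iff_of_abs (s : SeedSystem E I T q q') {S c x y : ZFSet.{u}}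
    (h : SeedAbs E S x y) (hS : c ∈ S) (hc : c ∈ T) :
    c ∈ s.ultraClass.embedding.toFun x ↔ c ∈ y := by
  simp only [SeedAbs, mm_iff, prMem_iff] at h
  rw [s.mem_embedding_iff hc]
  constructor
  · intro h1
    by_contra hn
    obtain ⟨Z, hZ, hd⟩ := (h c hS).2 hn
    obtain ⟨f, h2, h3⟩ := (h1.and (s.eventually_mem hZ)).exists
    exact hd _ h3 h2
  · intro h1
    obtain ⟨Z, hZ, hd⟩ := (h c hS).1 h1
    exact (s.eventually_mem hZ).mono fun f hf => hd _ hf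

theorem embedding_eq_of_abs (s : SeedSystem E I T q q') {x y : ZFSet.{u}} (h : SeedAbs E T x y)
    (hx : ∀ z ∈ x, z ∈ I) (hy : ∀ z ∈ y, z ∈ T) : s.ultraClass.embedding.toFun x = y := by
  ext z
  constructor
  · intro hz
    obtain ⟨p, hp⟩ := s.ultraClass.transClass_model _ (s.ultraClass.embedding.mem x) z hz
    have hT := s.exists_seed_of_mem p x z hx hp.symm hz
    exact (s.mem_embedding_iff_of_abs h hT hT).1 hz
  · intro hz
    exact (s.mem_embedding_iff_of_abs h (hy z hz) (hy z hz)).2 hz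

end SeedSystem

theorem toZFSet_natCast_mem (n : ℕ) :
    (n : Ordinal.{u}).toZFSet ∈ Ordinal.omega0.{u}.toZFSet :=
  Ordinal.mem_toZFSet_iff.2 ⟨n, Ordinal.natCast_lt_omega0 n, rfl⟩

theorem toZFSet_natCast_inj {m n : ℕ} (h : (m : Ordinal.{u}).toZFSet = (n : Ordinal.{u}).toZFSet) :
    m = n := by
  have := congrArg ZFSet.rank h
  rw [Ordinal.rank_toZFSet, Ordinal.rank_toZFSet] at this
  exact_mod_cast this

theorem SeedFIP.exists_realizer {E q q' : ZFSet.{u}} (h : SeedFIP E q q' Ordinal.omega0.{u}.toZFSet)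
    (R : Set (ZFSet.{u} × ZFSet.{u})) (hR : R.Countable) (hE : ∀ p ∈ R, ZFSet.pair p.1 p.2 ∈ E) :
    (Realizers q q' R).Nonempty := by
  rcases R.eq_empty_or_nonempty with rfl | hne
  · exact ⟨id, by simp [Realizers]⟩
  obtain ⟨r, rfl⟩ := hR.exists_eq_range hne
  simp only [SeedFIP, mm_iff, prMem_iff, trMem_iff] at h
  have hg : ∀ n c Y, ZFSet.pair n (ZFSet.pair c Y) ∈ ZFSet.range (fun k : ULift.{u} ℕ =>
      ZFSet.pair (k.down : Ordinal.{u}).toZFSet (ZFSet.pair (r k.down).1 (r k.down).2)) ↔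
        ∃ k : ℕ, n = (k : Ordinal.{u}).toZFSet ∧ c = (r k).1 ∧ Y = (r k).2 := by
    intro n c Y
    rw [ZFSet.mem_range]
    constructor
    · rintro ⟨⟨k⟩, hk⟩
      simp only [ZFSet.pair_inj] at hk
      exact ⟨k, hk.1.symm, hk.2.1.symm, hk.2.2.symm⟩
    · rintro ⟨k, rfl, rfl, rfl⟩
      exact ⟨⟨k⟩, rfl⟩
  obtain ⟨f, h1, h2, h3⟩ := h (ZFSet.range fun k : ULift.{u} ℕ =>
      ZFSet.pair (k.down : Ordinal.{u}).toZFSet (ZFSet.pair (r k.down).1 (r k.down).2)) (by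
    intro n c Y hn
    obtain ⟨k, rfl, rfl, rfl⟩ := (hg _ _ _).1 hn
    exact ⟨toZFSet_natCast_mem k, hE _ ⟨k, rfl⟩⟩) (by
    intro n c Y c' Y' hn hn'
    obtain ⟨k, rfl, rfl, rfl⟩ := (hg _ _ _).1 hn
    obtain ⟨l, hl, rfl, rfl⟩ := (hg _ _ _).1 hn'
    obtain rfl := toZFSet_natCast_inj hl
    exact ⟨rfl, rfl⟩)
  have h4 : ∀ k, ∃ x ∈ (r k).2, ZFSet.pair (r k).1 x ∈ f := fun k =>
    h1 _ _ _ ((hg _ _ _).2 ⟨k, rfl, rfl, rfl⟩)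
  have h5 : ∀ c ∈ Prod.fst '' Set.range r,
      ZFSet.pair c (Classical.epsilon fun x => ZFSet.pair c x ∈ f) ∈ f := by
    rintro _ ⟨_, ⟨k, rfl⟩, rfl⟩
    obtain ⟨x, -, hx⟩ := h4 k
    exact Classical.epsilon_spec (p := fun x => ZFSet.pair (r k).1 x ∈ f) ⟨x, hx⟩
  refine ⟨fun c => Classical.epsilon fun x => ZFSet.pair c x ∈ f, ?_, ?_⟩
  · rintro _ ⟨k, rfl⟩
    obtain ⟨x, hx, hp⟩ := h4 k
    have := h2 _ _ _ hp (h5 _ ⟨_, ⟨k, rfl⟩, rfl⟩)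
    change Classical.epsilon (fun x => ZFSet.pair (r k).1 x ∈ f) ∈ (r k).2
    rwa [← this]
  · intro c hc a ha b hb hq
    exact h3 _ _ _ _ _ _ (h5 c hc) (h5 a ha) (h5 b hb) hq

theorem SeedClosed.exists_seed {E q q' I T : ZFSet.{u}} (h : SeedClosed E q q' I T)
    (f : ZFSet.{u} → ZFSet.{u}) (b : ZFSet.{u}) (hb : b ∈ T) (Y : ZFSet.{u})
    (hY : ZFSet.pair b Y ∈ E) (hf : ∀ x ∈ Y, f x ∈ I) :
    ∃ c ∈ T, ∃ e Z, ZFSet.pair e (ZFSet.pair b c) ∈ q' ∧ ZFSet.pair e Z ∈ E ∧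
      ∀ p ∈ Z, ∃ x, ZFSet.pair p (ZFSet.pair x (f x)) ∈ q := by
  simp only [SeedClosed, mm_iff, prMem_iff, trMem_iff] at h
  have : Small.{u} {x // x ∈ Y} := ZFSet.small_coe Y
  obtain ⟨c, hc, e, Z, he, hZ, hp⟩ := h
    (ZFSet.range fun x : {x // x ∈ Y} => ZFSet.pair x.1 (f x.1)) b hb Y hY fun x hx =>
      ⟨f x, hf x hx, ZFSet.mem_range.2 ⟨⟨x, hx⟩, rfl⟩⟩
  refine ⟨c, hc, e, Z, he, hZ, fun p hpZ => ?_⟩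
  obtain ⟨x, y, h1, h2⟩ := hp p hpZ
  obtain ⟨⟨x', hx'⟩, h3⟩ := ZFSet.mem_range.1 h2
  obtain ⟨rfl, rfl⟩ := ZFSet.pair_inj.1 h3
  exact ⟨_, h1⟩

theorem isOrdinal_of_isOrd {x : ZFSet.{u}} (h : IsOrd x) : x.IsOrdinal :=
  ZFSet.isOrdinal_iff_forall_mem_isTransitive.2 h

theorem Reflected.exists_embedding {C A L : ZFSet.{u}}
    (h : Reflected C A L Ordinal.omega0.{u}.toZFSet) (hC : ∀ k ∈ C, IsOrd k)
    (hL : ∀ k ∈ C, ∀ l ∈ k, ∀ x : ZFSet.{u}, x.rank ≤ l.rank → ZFSet.pair x l ∈ L) :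
    ∃ k ∈ C, ∃ (N : Set ZFSet.{u}) (i : ElemEmbInto N), TransClass N ∧
      (∀ x : ZFSet.{u}, IsOrd x → x.rank < k.rank → i.toFun x = x) ∧
      i.toFun k ≠ k ∧ i.toFun A ∩ i.toFun k = A ∩ i.toFun k ∧
      ∃ w ∈ N, ∀ z : ZFSet.{u},
        z ∈ w ↔ ∃ x : ZFSet.{u}, x.rank < k.rank + Ordinal.omega0 ∧ z = i.toFun x := by
  obtain ⟨κ, W, I, T, E, q, q', κ', σ, K, hκC, hbig, hultra, hfip, hpair, hclosed, hmem, hcor⟩ := h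
  have hclosed' := hclosed.exists_seed
  have hfip' := hfip.exists_realizer
  obtain ⟨a1, a2, a3, a4, a5, a6, a7, a8, a9, a10⟩ := hbig
  obtain ⟨b1, b2, b3, b4, b5, b6⟩ := hcor
  simp only [SeedUltra, SeedPairing, SeedMem, mm_iff, prMem_iff, trMem_iff, Incl,
    TransSet] at *
  have hord := hC κ hκC
  have s : SeedSystem E I T q q' := {
    nonempty := ⟨κ, a2 _ a1⟩
    top := hultra.1
    ultra := hultra.2
    fip := hfip'
    pairing := hpair.1
    unpairing := hpair.2
    closed := hclosed'
    mem := hmem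
    trans_left := a9
    trans_right := a10 }
  have hκ : s.ultraClass.embedding.toFun κ = κ' := s.embedding_eq_of_abs b1 a3 a2
  have hW : ∀ n : ℕ, ∃ y ∈ W, ∀ z : ZFSet.{u}, z.rank < κ.rank + n → z ∈ y := by
    intro n
    induction n with
    | zero =>
      refine ⟨K, a5, fun z hz => ?_⟩
      rw [Nat.cast_zero, add_zero] at hz
      have hl : z.rank.toZFSet ∈ κ := by
        rw [← ZFSet.IsOrdinal.toZFSet_rank_eq (isOrdinal_of_isOrd hord)]
        exact Ordinal.mem_toZFSet_iff.2 ⟨_, hz, rfl⟩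
      exact a4 _ _ hl (hL κ hκC _ hl z (by rw [Ordinal.rank_toZFSet]))
    | succ n ih =>
      obtain ⟨y, hy, h1⟩ := ih
      obtain ⟨y', hy', h2⟩ := a8 y hy
      refine ⟨y', hy', fun z hz => h2 z fun w hw => h1 w ?_⟩
      have := ZFSet.rank_lt_of_mem hw
      rw [Nat.cast_succ, ← add_assoc, Order.lt_add_one_iff] at hz
      exact this.trans_le hz
  have hW' : ∀ x : ZFSet.{u}, x.rank < κ.rank + Ordinal.omega0 → x ∈ W := by
    intro x hx
    obtain ⟨a, ha, hxa⟩ := (Ordinal.lt_add_iff Ordinal.omega0_ne_zero).1 hx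
    obtain ⟨n, rfl⟩ := Ordinal.lt_omega0.1 ha
    obtain ⟨y, hy, hz⟩ := hW (n + 1)
    refine a6 y hy x (hz x (hxa.trans_lt ?_))
    rw [Nat.cast_succ, ← add_assoc]
    exact Order.lt_add_one_iff.2 le_rfl
  have hWe : ∀ x ∈ W, ∀ c ∈ σ, SeedAbs E T x c → s.ultraClass.embedding.toFun x = c := by
    intro x hx c hc habs
    exact s.embedding_eq_of_abs habs (a9 x (a7 x hx)) (a10 c (a10 σ b6 c hc))
  refine ⟨κ, hκC, s.ultraClass.model, s.ultraClass.embedding, s.ultraClass.transClass_model,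
    ?_, ?_, ?_, ?_⟩
  · intro x hx hr
    have hxκ : x ∈ κ := ((isOrdinal_of_isOrd hx).rank_lt_iff_mem (isOrdinal_of_isOrd hord)).1 hr
    exact s.embedding_eq_of_abs (b2 x hxκ) (a9 x (a3 x hxκ)) (a10 x (a10 κ (a2 κ a1) x hxκ))
  · rw [hκ]
    intro he
    exact ZFSet.mem_irrefl κ (he ▸ a1)
  · rw [hκ]
    ext z
    simp only [ZFSet.mem_inter]
    constructor
    · rintro ⟨h1, h2⟩
      exact ⟨(s.mem_embedding_iff_of_abs b3 h2 (a2 z h2)).1 h1, h2⟩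
    · rintro ⟨h1, h2⟩
      exact ⟨(s.mem_embedding_iff_of_abs b3 h2 (a2 z h2)).2 h1, h2⟩
  · have hlt : ∀ x : ZFSet.{u}, x ∈ ZFSet.vonNeumann (κ.rank + Ordinal.omega0) ↔
        x.rank < κ.rank + Ordinal.omega0 := fun x => ZFSet.mem_vonNeumann
    let w : SeedSystem.Functions T := ⟨fun h => h σ ∩ ZFSet.vonNeumann (κ.rank + Ordinal.omega0),
      σ, b6, fun x => x ∩ ZFSet.vonNeumann (κ.rank + Ordinal.omega0), rfl⟩
    have hw : ∀ z, z ∈ s.ultraClass.collapse w ↔ z ∈ σ ∧ z ∈ s.ultraClass.embedding.toFun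
        (ZFSet.vonNeumann (κ.rank + Ordinal.omega0)) := by
      intro z
      have hσ : z ∈ σ ↔ z ∈ s.ultraClass.collapse (SeedSystem.seed σ b6) := by
        rw [s.collapse_seed]
      rw [hσ]
      constructor
      · intro hz
        obtain ⟨p, hp, rfl⟩ := (s.ultraClass.mem_collapse _ _).1 hz
        constructor
        · refine (s.ultraClass.collapse_mem_iff _ _).2 ?_
          filter_upwards [hp] with f hf using (ZFSet.mem_inter.1 hf).1
        · refine (s.ultraClass.collapse_mem_iff _ _).2 ?_
          filter_upwards [hp] with f hf using (ZFSet.mem_inter.1 hf).2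
      · rintro ⟨h1, h2⟩
        obtain ⟨p, hp, rfl⟩ := (s.ultraClass.mem_collapse _ _).1 h1
        refine (s.ultraClass.collapse_mem_iff _ _).2 ?_
        have h3 := (s.ultraClass.collapse_mem_iff _ _).1 h2
        filter_upwards [hp, h3] with f hf hf' using ZFSet.mem_inter.2 ⟨hf, hf'⟩
    have hmemi : ∀ x y, s.ultraClass.embedding.toFun x ∈ s.ultraClass.embedding.toFun y ↔ x ∈ y :=
      fun x y => ⟨fun h => ((s.ultraClass.collapse_mem_iff _ _).1 h).exists.elim fun _ h => h,
        fun h => (s.ultraClass.collapse_mem_iff _ _).2 (.of_forall fun _ => h)⟩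
    refine ⟨_, ⟨w, rfl⟩, fun z => ?_⟩
    rw [hw]
    constructor
    · rintro ⟨h1, h2⟩
      obtain ⟨x, hx, habs⟩ := b5 z h1
      have he := hWe x hx z h1 habs
      rw [← he, hmemi, hlt] at h2
      exact ⟨x, h2, he.symm⟩
    · rintro ⟨x, hx, rfl⟩
      obtain ⟨c, hc, habs⟩ := b4 x (hW' x hx)
      rw [hmemi, hlt, hWe x (hW' x hx) c hc habs]
      exact ⟨hc, hx⟩

/-- `j : V → M` is elementary with critical point `δ`, and `M` contains the restriction of every
class function into `M` to the sets of rank less than `δ + ω + 2`. -/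
structure Supercompact (δ : ZFSet.{u}) {M : Set ZFSet.{u}} (j : ElemEmbInto M) : Prop where
  isOrd : IsOrd δ
  transClass : TransClass M
  fix : ∀ x ∈ δ, j.toFun x = x
  crit : j.toFun δ ≠ δ
  closed : ∀ s : ZFSet.{u} → ZFSet.{u}, (∀ x : ZFSet.{u}, s x ∈ M) →
    ∃ w ∈ M, ∀ f : ZFSet.{u}, f ∈ w ↔
      ∃ x : ZFSet.{u}, x.rank < δ.rank + Ordinal.omega0 + 2 ∧ f = ZFSet.pair x (s x)

namespace Supercompact

variable {δ : ZFSet.{u}} {M : Set ZFSet.{u}} {j : ElemEmbInto M}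

theorem isSetModel (s : Supercompact δ j) : IsSetModel (Subtype.val : M → ZFSet.{u}) :=
  isSetModel_val s.transClass

theorem map_mem_iff (_ : Supercompact δ j) (x y : ZFSet.{u}) : j.toFun x ∈ j.toFun y ↔ x ∈ y :=
  (transfer₂ j (fun _ _ a b => Mm a b) (.mem _ _) x y).symm

theorem map_pair (s : Supercompact δ j) (x y : ZFSet.{u}) :
    j.toFun (ZFSet.pair x y) = ZFSet.pair (j.toFun x) (j.toFun y) :=
  (s.isSetModel.isPr_iff _ _ _).1 ((transfer₃ j (fun _ _ a b c => IsPr a b c) (.isPr _ _ _)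
    (ZFSet.pair x y) x y).1 ((isPr_iff _ _ _).2 rfl))

theorem map_subset (s : Supercompact δ j) {x y : ZFSet.{u}} (h : ∀ z ∈ x, z ∈ y) :
    ∀ z ∈ j.toFun x, z ∈ j.toFun y := fun z hz =>
  (transfer₂ j (fun _ _ a b => Incl a b) (.incl _ _) x y).1 h
    ⟨z, s.transClass _ (j.mem x) z hz⟩ hz

theorem map_transSet (s : Supercompact δ j) {x : ZFSet.{u}} (h : ∀ y ∈ x, ∀ z ∈ y, z ∈ x) :
    ∀ y ∈ j.toFun x, ∀ z ∈ y, z ∈ j.toFun x := fun y hy z hz =>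
  have hyM := s.transClass _ (j.mem x) y hy
  (transfer₁ j (fun _ _ a => TransSet a) (.transSet _) x).1 h ⟨y, hyM⟩ hy
    ⟨z, s.transClass _ hyM z hz⟩ hz

theorem map_empty (s : Supercompact δ j) : j.toFun ∅ = ∅ := by
  have := (transfer₁ j (fun _ _ a => ∀ z, ¬ Mm z a) (.all (.not (.mem _ _))) ∅).1
    (fun z => ZFSet.notMem_empty z)
  rw [ZFSet.eq_empty]
  exact fun y hy => this ⟨y, s.transClass _ (j.mem ∅) y hy⟩ hy

theorem map_insert_self (s : Supercompact δ j) (x : ZFSet.{u}) :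
    j.toFun (insert x x) = insert (j.toFun x) (j.toFun x) := by
  have := (transfer₂ j (fun _ _ a b => ∀ z, Mm z a ↔ z = b ∨ Mm z b)
    (.all (.iff (.mem _ _) (.or (.eq _ _) (.mem _ _)))) (insert x x) x).1
    (fun z => ZFSet.mem_insert_iff)
  ext z
  rw [ZFSet.mem_insert_iff]
  constructor
  · intro hz
    have hzM := s.transClass _ (j.mem (insert x x)) z hz
    exact ((this ⟨z, hzM⟩).1 hz).imp (fun h => congrArg Subtype.val h) id
  · rintro (rfl | hz)
    · exact (this ⟨_, j.mem x⟩).2 (Or.inl rfl)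
    · exact (this ⟨z, s.transClass _ (j.mem x) z hz⟩).2 (Or.inr hz)

theorem pair_mem (s : Supercompact δ j) {x y : ZFSet.{u}} (hx : x ∈ M) (hy : y ∈ M) :
    ZFSet.pair x y ∈ M := by
  obtain ⟨p, hp⟩ := (transfer₁ j (fun X _ _ => ∀ a b : X, ∃ p, IsPr p a b)
    (.all (.all (.ex (.isPr _ _ _)))) ∅).1 (fun a b => ⟨_, (isPr_iff _ _ _).2 rfl⟩)
    ⟨x, hx⟩ ⟨y, hy⟩
  rw [s.isSetModel.isPr_iff] at hp
  exact hp ▸ p.2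

theorem mem_of_pair_mem (s : Supercompact δ j) {x y r : ZFSet.{u}} (hr : r ∈ M)
    (h : ZFSet.pair x y ∈ r) : x ∈ M ∧ y ∈ M := by
  obtain ⟨_, a, b, -, rfl, rfl⟩ := s.isSetModel.exists_fst_snd (r := ⟨r, hr⟩) h
  exact ⟨a.2, b.2⟩

theorem mem_of_triple_mem (s : Supercompact δ j) {x y z r : ZFSet.{u}} (hr : r ∈ M)
    (h : ZFSet.pair x (ZFSet.pair y z) ∈ r) : x ∈ M ∧ y ∈ M ∧ z ∈ M := by
  obtain ⟨_, a, b, -, rfl, hb⟩ := s.isSetModel.exists_fst_snd (r := ⟨r, hr⟩) h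
  obtain ⟨t, ht⟩ := s.isSetModel.trans b {y} (by rw [hb, ZFSet.pair]; simp)
  obtain ⟨t', ht'⟩ := s.isSetModel.trans b {y, z} (by rw [hb, ZFSet.pair]; simp)
  exact ⟨a.2, s.transClass _ t'.2 y (by rw [ht']; simp), s.transClass _ t'.2 z (by rw [ht']; simp)⟩

theorem mem_sUnion_of_pair_mem {x y r : ZFSet.{u}} (h : ZFSet.pair x y ∈ r) :
    x ∈ ZFSet.sUnion (ZFSet.sUnion r) ∧ y ∈ ZFSet.sUnion (ZFSet.sUnion r) := by
  have h1 : ({x, y} : ZFSet.{u}) ∈ ZFSet.sUnion r :=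
    ZFSet.mem_sUnion.2 ⟨_, h, by rw [ZFSet.pair]; simp⟩
  exact ⟨ZFSet.mem_sUnion.2 ⟨_, h1, by simp⟩, ZFSet.mem_sUnion.2 ⟨_, h1, by simp⟩⟩

theorem mem_of_image (s : Supercompact δ j) (Y : ZFSet.{u}) (hY : ∀ y ∈ Y, y ∈ M)
    (f : ZFSet.{u} → ZFSet.{u})
    (hf : ∀ y ∈ Y, ∃ x : ZFSet.{u}, x.rank < δ.rank + Ordinal.omega0 + 2 ∧ f x = y) : Y ∈ M := by
  classical
  by_cases hne : ∃ y, y ∈ Y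
  · obtain ⟨y₀, hy₀⟩ := hne
    obtain ⟨w, hwM, hw⟩ := s.closed (fun x => if f x ∈ Y then f x else y₀) (fun x => by
      split_ifs with h
      exacts [hY _ h, hY _ hy₀])
    obtain ⟨r, hr⟩ := (transfer₁ j
      (fun X _ _ => ∀ w : X, ∃ r : X, ∀ y, Mm y r ↔ ∃ x, PrMem w x y)
      (.all (.ex (.all (.iff (.mem _ _) (.ex (.prMem _ _ _)))))) ∅).1 (fun w => by
        refine ⟨ZFSet.sep (fun y => ∃ x, ZFSet.pair x y ∈ w) (ZFSet.sUnion (ZFSet.sUnion w)),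
          fun y => ?_⟩
        simp only [mm_iff, prMem_iff, ZFSet.mem_sep]
        exact ⟨fun h => h.2, fun h => ⟨h.elim fun x hx => (mem_sUnion_of_pair_mem hx).2, h⟩⟩)
      ⟨w, hwM⟩
    simp only [s.isSetModel.prMem_iff, s.isSetModel.mem_iff] at hr
    have : r.1 = Y := by
      ext y
      constructor
      · intro hy
        obtain ⟨x, hx⟩ := (hr ⟨y, s.transClass _ r.2 y hy⟩).1 hy
        obtain ⟨x', -, he⟩ := (hw _).1 hx
        have h2 : y = if f x' ∈ Y then f x' else y₀ := (ZFSet.pair_inj.1 he).2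
        rw [h2]
        split_ifs with h
        exacts [h, hy₀]
      · intro hy
        obtain ⟨x, hx, rfl⟩ := hf y hy
        have h1 : ZFSet.pair x (f x) ∈ w := (hw _).2 ⟨x, hx, by rw [if_pos hy]⟩
        exact (hr ⟨f x, hY _ hy⟩).2 ⟨⟨x, (s.mem_of_pair_mem hwM h1).1⟩, h1⟩
    exact this ▸ r.2
  · have : Y = ∅ := by
      rw [ZFSet.eq_empty]
      exact fun y hy => hne ⟨y, hy⟩
    rw [this, ← s.map_empty]
    exact j.mem ∅

theorem mem_of_rank_lt (s : Supercompact δ j) (x : ZFSet.{u}) :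
    x.rank < δ.rank + Ordinal.omega0 + 2 → x ∈ M := by
  induction x using ZFSet.inductionOn with | _ x ih
  intro hx
  have hlt : ∀ y ∈ x, y.rank < δ.rank + Ordinal.omega0 + 2 := fun y hy =>
    (ZFSet.rank_lt_of_mem hy).trans hx
  exact s.mem_of_image x (fun y hy => ih y hy (hlt y hy)) id fun y hy => ⟨y, hlt y hy, rfl⟩

theorem isOrdinal (s : Supercompact δ j) : δ.IsOrdinal := isOrdinal_of_isOrd s.isOrd

theorem mem_map_self (s : Supercompact δ j) : δ ∈ j.toFun δ := by
  have h1 := s.map_transSet (x := δ) s.isOrd.1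
  have h2 := (transfer₁ j (fun _ _ a => ∀ y, Mm y a → TransSet y)
    (.all (.imp (.mem _ _) (.transSet _))) δ).1 s.isOrd.2
  have hord : (j.toFun δ).IsOrdinal := isOrdinal_of_isOrd ⟨h1, fun y hy z hz w hw =>
    have hyM := s.transClass _ (j.mem δ) y hy
    have hzM := s.transClass _ hyM z hz
    h2 ⟨y, hyM⟩ hy ⟨z, hzM⟩ hz ⟨w, s.transClass _ hzM w hw⟩ hw⟩
  have hsub : δ ⊆ j.toFun δ := fun x hx => by
    rw [← s.fix x hx]
    exact (s.map_mem_iff _ _).2 hx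
  rcases (s.isOrdinal.subset_iff_eq_or_mem hord).1 hsub with h | h
  · exact absurd h.symm s.crit
  · exact h

theorem exists_mem (s : Supercompact δ j) : ∃ x, x ∈ δ := by
  by_contra h
  have : δ = ∅ := by
    rw [ZFSet.eq_empty]
    exact fun y hy => h ⟨y, hy⟩
  exact s.crit (by rw [this, s.map_empty])

theorem insert_self_mem (s : Supercompact δ j) {x : ZFSet.{u}} (hx : x ∈ δ) : insert x x ∈ δ := by
  have hx' := s.isOrdinal.mem hx
  have hord : (insert x x : ZFSet.{u}).IsOrdinal := by
    refine isOrdinal_of_isOrd ⟨fun y hy z hz => ?_, fun y hy => ?_⟩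
    · rw [ZFSet.mem_insert_iff] at hy ⊢
      rcases hy with rfl | hy
      · exact Or.inr hz
      · exact Or.inr (hx'.isTransitive.mem_trans hz hy)
    · rw [ZFSet.mem_insert_iff] at hy
      rcases hy with rfl | hy
      · exact hx'.isTransitive
      · exact (hx'.mem hy).isTransitive
  have hsub : (insert x x : ZFSet.{u}) ⊆ δ := fun y hy => by
    rw [ZFSet.mem_insert_iff] at hy
    rcases hy with rfl | hy
    · exact hx
    · exact s.isOrdinal.isTransitive.mem_trans hy hx
  rcases (hord.subset_iff_eq_or_mem s.isOrdinal).1 hsub with h | h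
  · exact absurd (by rw [← h, s.map_insert_self, s.fix x hx]) s.crit
  · exact h

theorem map_natCast (s : Supercompact δ j) (n : ℕ) :
    j.toFun (n : Ordinal.{u}).toZFSet = (n : Ordinal.{u}).toZFSet := by
  induction n with
  | zero => rw [Nat.cast_zero, Ordinal.toZFSet_zero, s.map_empty]
  | succ n ih => rw [Nat.cast_succ, Ordinal.toZFSet_add_one, s.map_insert_self, ih]

theorem mem_omega_iff {z : ZFSet.{u}} :
    z ∈ Ordinal.omega0.{u}.toZFSet ↔ ∃ n : ℕ, z = (n : Ordinal.{u}).toZFSet := by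
  rw [Ordinal.mem_toZFSet_iff]
  constructor
  · rintro ⟨a, ha, rfl⟩
    obtain ⟨n, rfl⟩ := Ordinal.lt_omega0.1 ha
    exact ⟨n, rfl⟩
  · rintro ⟨n, rfl⟩
    exact ⟨n, Ordinal.natCast_lt_omega0 n, rfl⟩

theorem map_of_mem_omega (s : Supercompact δ j) {z : ZFSet.{u}}
    (hz : z ∈ Ordinal.omega0.{u}.toZFSet) : j.toFun z = z := by
  obtain ⟨n, rfl⟩ := mem_omega_iff.1 hz
  exact s.map_natCast n

theorem map_omega (s : Supercompact δ j) :
    j.toFun Ordinal.omega0.{u}.toZFSet = Ordinal.omega0.{u}.toZFSet := by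
  have h := (transfer₁ j (fun _ _ a => ∀ z, Mm z a → (∀ y, ¬ Mm y z) ∨
      ∃ y, Mm y a ∧ ∀ x, Mm x z ↔ x = y ∨ Mm x y)
    (.all (.imp (.mem _ _) (.or (.all (.not (.mem _ _)))
      (.ex (.and (.mem _ _) (.all (.iff (.mem _ _) (.or (.eq _ _) (.mem _ _)))))))))
    Ordinal.omega0.{u}.toZFSet).1 (by
      intro z hz
      obtain ⟨n, rfl⟩ := mem_omega_iff.1 hz
      cases n with
      | zero =>
        left
        intro y hy
        rw [Nat.cast_zero, Ordinal.toZFSet_zero, mm_iff] at hy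
        exact ZFSet.notMem_empty y hy
      | succ n =>
        right
        refine ⟨(n : Ordinal.{u}).toZFSet, mem_omega_iff.2 ⟨n, rfl⟩, fun x => ?_⟩
        rw [Nat.cast_succ, Ordinal.toZFSet_add_one, mm_iff, ZFSet.mem_insert_iff]
        rfl)
  have key : ∀ z : ZFSet.{u}, z ∈ j.toFun Ordinal.omega0.{u}.toZFSet →
      z ∈ Ordinal.omega0.{u}.toZFSet := by
    intro z
    induction z using ZFSet.inductionOn with | _ z ih
    intro hz
    have hzM := s.transClass _ (j.mem _) z hz
    rcases h ⟨z, hzM⟩ hz with h0 | ⟨y, hy, hyz⟩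
    · refine mem_omega_iff.2 ⟨0, ?_⟩
      rw [Nat.cast_zero, Ordinal.toZFSet_zero, ZFSet.eq_empty]
      exact fun y hy => h0 ⟨y, s.transClass _ hzM y hy⟩ hy
    · obtain ⟨n, hn⟩ := mem_omega_iff.1 (ih y ((hyz y).2 (Or.inl rfl)) hy)
      refine mem_omega_iff.2 ⟨n + 1, ?_⟩
      rw [Nat.cast_succ, Ordinal.toZFSet_add_one, ← hn]
      ext x
      rw [ZFSet.mem_insert_iff]
      constructor
      · intro hx
        exact ((hyz ⟨x, s.transClass _ hzM x hx⟩).1 hx).imp (fun h => congrArg Subtype.val h) id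
      · rintro (rfl | hx)
        · exact (hyz y).2 (Or.inl rfl)
        · exact (hyz ⟨x, s.transClass _ y.2 x hx⟩).2 (Or.inr hx)
  ext z
  refine ⟨key z, fun hz => ?_⟩
  rw [← s.map_of_mem_omega hz]
  exact (s.map_mem_iff _ _).2 hz

/-- The set on which the seed measures live, `V_{δ+ω+1}`. -/
noncomputable def dom (δ : ZFSet.{u}) : ZFSet.{u} :=
  ZFSet.vonNeumann (δ.rank + Ordinal.omega0 + 1)

theorem mem_dom {x : ZFSet.{u}} : x ∈ dom δ ↔ x.rank ≤ δ.rank + Ordinal.omega0 := by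
  rw [dom, ZFSet.mem_vonNeumann, Order.lt_add_one_iff]

theorem subset_dom {X : ZFSet.{u}} :
    (∀ z ∈ X, z ∈ dom δ) ↔ X.rank < δ.rank + Ordinal.omega0 + 2 := by
  rw [← one_add_one_eq_two, ← add_assoc, Order.lt_add_one_iff]
  exact ZFSet.subset_vonNeumann

theorem rank_lt_of_mem_dom {x : ZFSet.{u}} (h : x ∈ dom δ) :
    x.rank < δ.rank + Ordinal.omega0 + 2 :=
  subset_dom.1 fun _ hz => (ZFSet.isTransitive_vonNeumann _).mem_trans hz h

theorem dom_trans {x y : ZFSet.{u}} (hx : x ∈ dom δ) (hy : y ∈ x) : y ∈ dom δ :=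
  (ZFSet.isTransitive_vonNeumann _).mem_trans hy hx

theorem mem_dom_of_mem {x : ZFSet.{u}} (hx : x ∈ δ) : x ∈ dom δ :=
  mem_dom.2 ((ZFSet.rank_lt_of_mem hx).le.trans le_self_add)

theorem dom_mem (s : Supercompact δ j) : dom δ ∈ M :=
  s.mem_of_rank_lt _ (subset_dom.1 fun _ h => h)

/-- `q` is the converse of a pairing function on `dom δ`. -/
structure Coding (δ q : ZFSet.{u}) : Prop where
  eq_of_mem : ∀ t ∈ q, ∃ p ∈ dom δ, ∃ x ∈ dom δ, ∃ y ∈ dom δ,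
    t = ZFSet.pair p (ZFSet.pair x y)
  total : ∀ x ∈ dom δ, ∀ y ∈ dom δ, ∃ p ∈ dom δ, ZFSet.pair p (ZFSet.pair x y) ∈ q
  inj : ∀ p x y x' y', ZFSet.pair p (ZFSet.pair x y) ∈ q → ZFSet.pair p (ZFSet.pair x' y') ∈ q →
    x = x' ∧ y = y'

theorem exists_coding (δ : ZFSet.{u}) : ∃ q, Coding δ q := by
  have : Infinite {x // x ∈ dom δ} := by
    refine Infinite.of_injective (fun n : ℕ => ⟨(n : Ordinal.{u}).toZFSet, mem_dom.2 ?_⟩) ?_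
    · rw [Ordinal.rank_toZFSet]
      exact (Ordinal.natCast_lt_omega0 n).le.trans le_add_self
    · intro n m h
      exact Nat.cast_injective (Ordinal.toZFSet_injective (congrArg Subtype.val h))
  obtain ⟨f⟩ : Nonempty ({x // x ∈ dom δ} × {x // x ∈ dom δ} ≃ {x // x ∈ dom δ}) := by
    rw [← Cardinal.eq, ← Cardinal.mul_def]
    exact Cardinal.mul_eq_self (Cardinal.aleph0_le_mk _)
  refine ⟨ZFSet.sep (fun t => ∃ x y, t = ZFSet.pair (f (x, y)).1 (ZFSet.pair x.1 y.1))
    (ZFSet.prod (dom δ) (ZFSet.prod (dom δ) (dom δ))), ?_, ?_, ?_⟩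
  · intro t ht
    obtain ⟨x, y, rfl⟩ := (ZFSet.mem_sep.1 ht).2
    exact ⟨_, (f (x, y)).2, _, x.2, _, y.2, rfl⟩
  · intro x hx y hy
    refine ⟨_, (f (⟨x, hx⟩, ⟨y, hy⟩)).2, ZFSet.mem_sep.2 ⟨?_, ⟨x, hx⟩, ⟨y, hy⟩, rfl⟩⟩
    exact ZFSet.pair_mem_prod.2 ⟨(f _).2, ZFSet.pair_mem_prod.2 ⟨hx, hy⟩⟩
  · intro p x y x' y' h h'
    obtain ⟨a, b, hab⟩ := (ZFSet.mem_sep.1 h).2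
    obtain ⟨a', b', hab'⟩ := (ZFSet.mem_sep.1 h').2
    obtain ⟨rfl, h1⟩ := ZFSet.pair_inj.1 hab
    obtain ⟨h2, h3⟩ := ZFSet.pair_inj.1 hab'
    obtain ⟨rfl, rfl⟩ := ZFSet.pair_inj.1 h1
    obtain ⟨rfl, rfl⟩ := ZFSet.pair_inj.1 h3
    have := f.injective (Subtype.ext h2)
    rw [Prod.mk.injEq, Subtype.ext_iff, Subtype.ext_iff] at this
    exact this

theorem Coding.mem_dom {q p x y : ZFSet.{u}} (hq : Coding δ q)
    (h : ZFSet.pair p (ZFSet.pair x y) ∈ q) : p ∈ dom δ ∧ x ∈ dom δ ∧ y ∈ dom δ := by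
  obtain ⟨p', hp, x', hx, y', hy, he⟩ := hq.eq_of_mem _ h
  obtain ⟨rfl, h2⟩ := ZFSet.pair_inj.1 he
  obtain ⟨rfl, rfl⟩ := ZFSet.pair_inj.1 h2
  exact ⟨hp, hx, hy⟩

theorem coding_mem (s : Supercompact δ j) {q : ZFSet.{u}} (hq : Coding δ q) : q ∈ M := by
  classical
  refine s.mem_of_image q (fun t ht => ?_)
    (fun p => if h : ∃ z, ZFSet.pair p z ∈ q then ZFSet.pair p h.choose else ∅) fun t ht => ?_
  · obtain ⟨p, hp, x, hx, y, hy, rfl⟩ := hq.eq_of_mem t ht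
    exact s.pair_mem (s.mem_of_rank_lt _ (rank_lt_of_mem_dom hp)) (s.pair_mem
      (s.mem_of_rank_lt _ (rank_lt_of_mem_dom hx)) (s.mem_of_rank_lt _ (rank_lt_of_mem_dom hy)))
  · obtain ⟨p, hp, x, hx, y, hy, rfl⟩ := hq.eq_of_mem t ht
    refine ⟨p, rank_lt_of_mem_dom hp, ?_⟩
    have h : ∃ z, ZFSet.pair p z ∈ q := ⟨_, ht⟩
    rw [dif_pos h]
    obtain ⟨p', -, x', -, y', -, he⟩ := hq.eq_of_mem _ h.choose_spec
    have h1 := h.choose_spec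
    rw [(ZFSet.pair_inj.1 he).2] at h1 ⊢
    obtain ⟨rfl, rfl⟩ := hq.inj _ _ _ _ _ ht h1
    rfl

/-- The relation sending a seed `c` in the image of `dom δ` to its ultrafilter on `dom δ`. -/
noncomputable def seedMeasure (δ : ZFSet.{u}) {M : Set ZFSet.{u}} (j : ElemEmbInto M) :
    ZFSet.{u} :=
  ZFSet.sep (fun t => ∃ c X, t = ZFSet.pair c X ∧ c ∈ j.toFun X)
    (ZFSet.prod (j.toFun (dom δ)) (ZFSet.powerset (dom δ)))

theorem pair_mem_seedMeasure (s : Supercompact δ j) {c X : ZFSet.{u}} :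
    ZFSet.pair c X ∈ seedMeasure δ j ↔ (∀ z ∈ X, z ∈ dom δ) ∧ c ∈ j.toFun X := by
  rw [seedMeasure, ZFSet.mem_sep, ZFSet.pair_mem_prod, ZFSet.mem_powerset]
  constructor
  · rintro ⟨⟨-, hX⟩, c', X', he, h⟩
    obtain ⟨rfl, rfl⟩ := ZFSet.pair_inj.1 he
    exact ⟨hX, h⟩
  · rintro ⟨hX, h⟩
    exact ⟨⟨s.map_subset hX _ h, hX⟩, c, X, rfl, h⟩

theorem seedMeasure_mem (s : Supercompact δ j) : seedMeasure δ j ∈ M := by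
  obtain ⟨G, hGM, hG⟩ := s.closed j.toFun j.mem
  obtain ⟨E, hE⟩ := (transfer₁ j
    (fun X _ _ => ∀ G T : X, ∃ E : X, ∀ e, Mm e E ↔
      ∃ c Y Z, Mm c T ∧ PrMem G Y Z ∧ Mm c Z ∧ IsPr e c Y)
    (.all (.all (.ex (.all (.iff (.mem _ _) (.ex (.ex (.ex (.and (.mem _ _)
      (.and (.prMem _ _ _) (.and (.mem _ _) (.isPr _ _ _))))))))))))
    ∅).1 (fun G T => by
      refine ⟨ZFSet.sep (fun e => ∃ c Y Z, c ∈ T ∧ ZFSet.pair Y Z ∈ G ∧ c ∈ Z ∧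
        e = ZFSet.pair c Y) (ZFSet.prod T (ZFSet.sUnion (ZFSet.sUnion G))), fun e => ?_⟩
      simp only [mm_iff, prMem_iff, isPr_iff, ZFSet.mem_sep]
      refine ⟨fun h => h.2, fun h => ⟨?_, h⟩⟩
      obtain ⟨c, Y, Z, hc, hYZ, -, rfl⟩ := h
      exact ZFSet.pair_mem_prod.2 ⟨hc, (mem_sUnion_of_pair_mem hYZ).1⟩)
    ⟨G, hGM⟩ ⟨_, j.mem (dom δ)⟩
  simp only [s.isSetModel.prMem_iff, s.isSetModel.mem_iff, s.isSetModel.isPr_iff] at hE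
  have : E.1 = seedMeasure δ j := by
    ext e
    constructor
    · intro he
      obtain ⟨c, Y, Z, hc, hYZ, hcZ, he⟩ := (hE ⟨e, s.transClass _ E.2 e he⟩).1 he
      obtain ⟨x, hx, hp⟩ := (hG _).1 hYZ
      obtain ⟨rfl, h2⟩ := ZFSet.pair_inj.1 hp
      change e = _ at he
      rw [he, s.pair_mem_seedMeasure]
      exact ⟨subset_dom.2 hx, h2 ▸ hcZ⟩
    · intro he
      obtain ⟨c, X, rfl, -⟩ := (ZFSet.mem_sep.1 he).2
      obtain ⟨hX, hc⟩ := s.pair_mem_seedMeasure.1 he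
      have hXM := s.mem_of_rank_lt X (subset_dom.1 hX)
      have hcM := s.transClass _ (j.mem X) c hc
      exact (hE ⟨_, s.pair_mem hcM hXM⟩).2 ⟨⟨c, hcM⟩, ⟨X, hXM⟩, ⟨_, j.mem X⟩,
        s.map_subset hX c hc, (hG _).2 ⟨X, subset_dom.1 hX, rfl⟩, hc, rfl⟩
  exact this ▸ E.2

theorem mem_map_or (s : Supercompact δ j) (I Y : ZFSet.{u}) {t : ZFSet.{u}}
    (ht : t ∈ j.toFun I) : t ∈ j.toFun Y ∨ t ∈ j.toFun (I \ Y) :=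
  (transfer₃ j (fun _ _ a b c => ∀ t, Mm t a → Mm t b ∨ Mm t c)
    (.all (.imp (.mem _ _) (.or (.mem _ _) (.mem _ _)))) I Y (I \ Y)).1
    (fun t ht => by
      simp only [mm_iff, ZFSet.mem_sdiff] at ht ⊢
      tauto) ⟨t, s.transClass _ (j.mem I) t ht⟩ ht

theorem seedUltra (s : Supercompact δ j) : SeedUltra (X := M) ⟨seedMeasure δ j, s.seedMeasure_mem⟩
    ⟨dom δ, s.dom_mem⟩ ⟨_, j.mem (dom δ)⟩ := by
  simp only [SeedUltra, Incl, s.isSetModel.prMem_iff, s.isSetModel.mem_iff, s.pair_mem_seedMeasure]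
  refine ⟨fun c hc => ⟨fun z hz => hz, hc⟩, fun c hc Y hY => ?_⟩
  have hY' : ∀ z ∈ Y.1, z ∈ dom δ := fun z hz => hY ⟨z, s.transClass _ Y.2 z hz⟩ hz
  refine (s.mem_map_or _ Y.1 hc).imp (fun h => ⟨hY', h⟩) fun h => ?_
  have hd : ∀ z ∈ dom δ \ Y.1, z ∈ dom δ := fun z hz => (ZFSet.mem_sdiff.1 hz).1
  exact ⟨⟨_, s.mem_of_rank_lt _ (subset_dom.1 hd)⟩, ⟨hd, h⟩,
    fun z hz hz' => (ZFSet.mem_sdiff.1 hz').2 hz⟩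

theorem map_coding_total (s : Supercompact δ j) {q : ZFSet.{u}} (hq : Coding δ q)
    {a b : ZFSet.{u}} (ha : a ∈ j.toFun (dom δ)) (hb : b ∈ j.toFun (dom δ)) :
    ∃ c ∈ j.toFun (dom δ), ZFSet.pair c (ZFSet.pair a b) ∈ j.toFun q := by
  have key := (transfer₂ j (fun _ _ q d => ∀ a b, Mm a d → Mm b d → ∃ c, Mm c d ∧ TrMem q c a b)
    (.all (.all (.imp (.mem _ _) (.imp (.mem _ _) (.ex (.and (.mem _ _) (.trMem _ _ _ _))))))) q
    (dom δ)).1 fun a b ha hb => (hq.total a ha b hb).imp fun c hc =>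
      ⟨hc.1, (trMem_iff _ _ _ _).2 hc.2⟩
  obtain ⟨c, hc, h⟩ := key ⟨a, s.transClass _ (j.mem _) a ha⟩ ⟨b, s.transClass _ (j.mem _) b hb⟩
    ha hb
  rw [s.isSetModel.trMem_iff] at h
  exact ⟨c, hc, h⟩

theorem map_coding_mem (s : Supercompact δ j) {q : ZFSet.{u}} (hq : Coding δ q)
    {p a b : ZFSet.{u}} (h : ZFSet.pair p (ZFSet.pair a b) ∈ j.toFun q) :
    p ∈ j.toFun (dom δ) ∧ a ∈ j.toFun (dom δ) ∧ b ∈ j.toFun (dom δ) := by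
  obtain ⟨hpM, haM, hbM⟩ := s.mem_of_triple_mem (j.mem q) h
  exact (transfer₂ j (fun _ _ q d => ∀ p a b, TrMem q p a b → Mm p d ∧ Mm a d ∧ Mm b d)
    (.all (.all (.all (.imp (.trMem _ _ _ _) (.and (.mem _ _) (.and (.mem _ _) (.mem _ _)))))))
    q (dom δ)).1 (fun p a b h => hq.mem_dom ((trMem_iff _ _ _ _).1 h)) ⟨p, hpM⟩ ⟨a, haM⟩ ⟨b, hbM⟩
    ((s.isSetModel.trMem_iff _ _ _ _).2 h)

theorem seedPairing (s : Supercompact δ j) {q : ZFSet.{u}} (hq : Coding δ q) :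
    SeedPairing (X := M) ⟨q, s.coding_mem hq⟩ ⟨_, j.mem q⟩ ⟨_, j.mem (dom δ)⟩ := by
  simp only [SeedPairing, s.isSetModel.trMem_iff, s.isSetModel.mem_iff]
  refine ⟨fun a ha b hb => ?_, fun p x y x' y' h h' => ?_⟩
  · obtain ⟨c, hc, h⟩ := s.map_coding_total hq ha hb
    exact ⟨⟨c, s.transClass _ (j.mem _) c hc⟩, hc, h⟩
  · exact (hq.inj _ _ _ _ _ h h').imp Subtype.ext Subtype.ext

theorem exists_sep (δ : ZFSet.{u}) (P : ZFSet.{u} → Prop) :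
    ∃ Z : ZFSet.{u}, ∀ p, p ∈ Z ↔ p ∈ dom δ ∧ P p :=
  ⟨ZFSet.sep P (dom δ), fun _ => ZFSet.mem_sep⟩

theorem seedMem (s : Supercompact δ j) {q : ZFSet.{u}} (hq : Coding δ q) :
    SeedMem (X := M) ⟨seedMeasure δ j, s.seedMeasure_mem⟩ ⟨q, s.coding_mem hq⟩ ⟨_, j.mem q⟩
      ⟨_, j.mem (dom δ)⟩ := by
  simp only [SeedMem, s.isSetModel.trMem_iff, s.isSetModel.mem_iff, s.isSetModel.prMem_iff,
    s.pair_mem_seedMeasure]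
  intro c hc c' hc' e he
  have he' := (s.map_coding_mem hq he).1
  have heM := s.transClass _ (j.mem _) _ he'
  constructor
  · intro h
    obtain ⟨Z, hZ⟩ := exists_sep δ fun p => ∀ x y, ZFSet.pair p (ZFSet.pair x y) ∈ q → x ∈ y
    have hZ' : ∀ z ∈ Z, z ∈ dom δ := fun z hz => ((hZ z).1 hz).1
    have := (transfer₂ j (fun _ _ q Z => ∀ p x y, TrMem q p x y → Mm x y → Mm p Z)
      (.all (.all (.all (.imp (.trMem _ _ _ _) (.imp (.mem _ _) (.mem _ _)))))) q Z).1
      (fun p x y hp hxy => by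
        rw [trMem_iff] at hp
        refine (hZ p).2 ⟨(hq.mem_dom hp).1, fun x' y' hp' => ?_⟩
        obtain ⟨rfl, rfl⟩ := hq.inj _ _ _ _ _ hp hp'
        exact hxy) e c' c ((s.isSetModel.trMem_iff _ _ _ _).2 he) h
    exact ⟨⟨Z, s.mem_of_rank_lt _ (subset_dom.1 hZ')⟩, ⟨hZ', this⟩, fun p hp x y hq =>
      ((hZ p).1 hp).2 _ _ hq⟩
  · intro h
    obtain ⟨Z, hZ⟩ := exists_sep δ fun p => ∀ x y, ZFSet.pair p (ZFSet.pair x y) ∈ q → x ∉ y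
    have hZ' : ∀ z ∈ Z, z ∈ dom δ := fun z hz => ((hZ z).1 hz).1
    have := (transfer₂ j (fun _ _ q Z => ∀ p x y, TrMem q p x y → ¬ Mm x y → Mm p Z)
      (.all (.all (.all (.imp (.trMem _ _ _ _) (.imp (.not (.mem _ _)) (.mem _ _)))))) q Z).1
      (fun p x y hp hxy => by
        rw [trMem_iff] at hp
        refine (hZ p).2 ⟨(hq.mem_dom hp).1, fun x' y' hp' => ?_⟩
        obtain ⟨rfl, rfl⟩ := hq.inj _ _ _ _ _ hp hp'
        exact hxy) e c' c ((s.isSetModel.trMem_iff _ _ _ _).2 he) h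
    exact ⟨⟨Z, s.mem_of_rank_lt _ (subset_dom.1 hZ')⟩, ⟨hZ', this⟩, fun p hp x y hq =>
      ((hZ p).1 hp).2 _ _ hq⟩

theorem seedClosed (s : Supercompact δ j) {q : ZFSet.{u}} (hq : Coding δ q) :
    SeedClosed (X := M) ⟨seedMeasure δ j, s.seedMeasure_mem⟩ ⟨q, s.coding_mem hq⟩ ⟨_, j.mem q⟩
      ⟨dom δ, s.dom_mem⟩ ⟨_, j.mem (dom δ)⟩ := by
  simp only [SeedClosed, s.isSetModel.trMem_iff, s.isSetModel.mem_iff, s.isSetModel.prMem_iff,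
    s.pair_mem_seedMeasure]
  intro f b hb Y hY hf
  obtain ⟨c, hc, hbc⟩ := (transfer₃ j
    (fun _ _ Y I f => ∀ x, Mm x Y → ∃ y, Mm y I ∧ PrMem f x y)
    (.all (.imp (.mem _ _) (.ex (.and (.mem _ _) (.prMem _ _ _))))) Y.1 (dom δ) f.1).1
    (fun x hx => by
      obtain ⟨y, hy, hxy⟩ := hf ⟨x, s.transClass _ Y.2 x hx⟩ hx
      exact ⟨y, hy, (prMem_iff _ _ _).2 hxy⟩) b hY.2
  obtain ⟨e, he, hebc⟩ := s.map_coding_total hq hb hc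
  obtain ⟨Z, hZ⟩ := exists_sep δ fun p =>
    ∃ x y, ZFSet.pair p (ZFSet.pair x y) ∈ q ∧ ZFSet.pair x y ∈ f.1
  have heM := s.transClass _ (j.mem _) e he
  have hZ' : ∀ z ∈ Z, z ∈ dom δ := fun z hz => ((hZ z).1 hz).1
  have := (transfer₃ j (fun _ _ q f Z => ∀ p x y, TrMem q p x y → PrMem f x y → Mm p Z)
    (.all (.all (.all (.imp (.trMem _ _ _ _) (.imp (.prMem _ _ _) (.mem _ _)))))) q f.1 Z).1
    (fun p x y hp hxy => by
      rw [trMem_iff] at hp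
      rw [prMem_iff] at hxy
      exact (hZ p).2 ⟨(hq.mem_dom hp).1, x, y, hp, hxy⟩)
    ⟨e, heM⟩ b c ((s.isSetModel.trMem_iff _ _ _ _).2 hebc) hbc
  refine ⟨c, hc, ⟨e, heM⟩, ⟨Z, s.mem_of_rank_lt _ (subset_dom.1 hZ')⟩, hebc, ⟨hZ', this⟩,
    fun p hp => ?_⟩
  obtain ⟨x, y, h1, h2⟩ := ((hZ p).1 hp).2
  obtain ⟨hxM, hyM⟩ := s.mem_of_pair_mem f.2 h2
  exact ⟨⟨x, hxM⟩, ⟨y, hyM⟩, h1, h2⟩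

theorem seedAbs_map (s : Supercompact δ j) {x : ZFSet.{u}} (hx : x ∈ M) :
    SeedAbs (X := M) ⟨seedMeasure δ j, s.seedMeasure_mem⟩ ⟨_, j.mem (dom δ)⟩ ⟨x, hx⟩
      ⟨_, j.mem x⟩ := by
  simp only [SeedAbs, s.isSetModel.mem_iff, s.isSetModel.prMem_iff, s.pair_mem_seedMeasure]
  intro t ht
  constructor
  · intro h
    obtain ⟨Z, hZ⟩ := exists_sep δ fun p => p ∈ x
    have hZ' : ∀ z ∈ Z, z ∈ dom δ := fun z hz => ((hZ z).1 hz).1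
    have := (transfer₃ j (fun _ _ I x Z => ∀ t, Mm t I → Mm t x → Mm t Z)
      (.all (.imp (.mem _ _) (.imp (.mem _ _) (.mem _ _)))) (dom δ) x Z).1
      (fun t h1 h2 => (hZ t).2 ⟨h1, h2⟩) t ht h
    exact ⟨⟨Z, s.mem_of_rank_lt _ (subset_dom.1 hZ')⟩, ⟨hZ', this⟩, fun z hz => ((hZ z).1 hz).2⟩
  · intro h
    have hd : ∀ z ∈ dom δ \ x, z ∈ dom δ := fun z hz => (ZFSet.mem_sdiff.1 hz).1
    exact ⟨⟨_, s.mem_of_rank_lt _ (subset_dom.1 hd)⟩, ⟨hd, (s.mem_map_or _ x ht).resolve_left h⟩,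
      fun z hz => (ZFSet.mem_sdiff.1 hz).2⟩

theorem seedAbs_subset (s : Supercompact δ j) {A : ZFSet.{u}} (hA : A ⊆ δ) :
    SeedAbs (X := M) ⟨seedMeasure δ j, s.seedMeasure_mem⟩ ⟨_, j.mem δ⟩ ⟨_, j.mem A⟩
      ⟨_, j.mem A⟩ := by
  simp only [SeedAbs, s.isSetModel.mem_iff, s.isSetModel.prMem_iff, s.pair_mem_seedMeasure]
  have hmap : ∀ z ∈ δ, z ∈ j.toFun A ↔ z ∈ A := fun z hz => by
    conv_lhs => rw [← s.fix z hz]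
    exact s.map_mem_iff z A
  intro t ht
  constructor
  · intro h
    have hA' : ∀ z ∈ A, z ∈ dom δ := fun z hz => mem_dom_of_mem (hA hz)
    exact ⟨⟨A, s.mem_of_rank_lt _ (subset_dom.1 hA')⟩, ⟨hA', h⟩, fun z hz =>
      (hmap z (hA hz)).2 hz⟩
  · intro h
    have hd : ∀ z ∈ δ \ A, z ∈ dom δ := fun z hz => mem_dom_of_mem (ZFSet.mem_sdiff.1 hz).1
    exact ⟨⟨_, s.mem_of_rank_lt _ (subset_dom.1 hd)⟩, ⟨hd, (s.mem_map_or _ A ht).resolve_left h⟩,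
      fun z hz hz' => (ZFSet.mem_sdiff.1 hz).2 ((hmap z (ZFSet.mem_sdiff.1 hz).1).1 hz')⟩

/-- The set `V_{δ+ω}`. -/
noncomputable def lower (δ : ZFSet.{u}) : ZFSet.{u} :=
  ZFSet.vonNeumann (δ.rank + Ordinal.omega0)

theorem mem_lower {x : ZFSet.{u}} : x ∈ lower δ ↔ x.rank < δ.rank + Ordinal.omega0 :=
  ZFSet.mem_vonNeumann

theorem subset_lower {x : ZFSet.{u}} : (∀ z ∈ x, z ∈ lower δ) ↔ x ∈ dom δ := by
  rw [mem_dom]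
  exact ZFSet.subset_vonNeumann

theorem lower_subset {x : ZFSet.{u}} (h : x ∈ lower δ) : x ∈ dom δ :=
  mem_dom.2 (mem_lower.1 h).le

theorem lower_mem (s : Supercompact δ j) : lower δ ∈ M :=
  s.mem_of_rank_lt _ (rank_lt_of_mem_dom (subset_lower.1 fun _ h => h))

theorem exists_image (j : ElemEmbInto M) (x : ZFSet.{u}) :
    ∃ y : ZFSet.{u}, ∀ z, z ∈ y ↔ ∃ w ∈ x, j.toFun w = z :=
  ⟨ZFSet.range fun w : {w // w ∈ x} => j.toFun w, fun z => by
    rw [ZFSet.mem_range, Subtype.exists]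
    exact ⟨fun ⟨w, hw, h⟩ => ⟨w, hw, h⟩, fun ⟨w, hw, h⟩ => ⟨w, hw, h⟩⟩⟩

theorem image_mem (s : Supercompact δ j) {σ : ZFSet.{u}}
    (hσ : ∀ z, z ∈ σ ↔ ∃ w ∈ lower δ, j.toFun w = z) : σ ∈ M :=
  s.mem_of_image σ (fun y hy => by
    obtain ⟨w, -, rfl⟩ := (hσ y).1 hy
    exact j.mem w) j.toFun fun y hy => by
      obtain ⟨w, hw, rfl⟩ := (hσ y).1 hy
      exact ⟨w, rank_lt_of_mem_dom (lower_subset hw), rfl⟩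

theorem image_mem_map_dom (s : Supercompact δ j) {σ : ZFSet.{u}}
    (hσ : ∀ z, z ∈ σ ↔ ∃ w ∈ lower δ, j.toFun w = z) : σ ∈ j.toFun (dom δ) :=
  (transfer₂ j (fun _ _ W I => ∀ z, Incl z W → Mm z I) (.all (.imp (.incl _ _) (.mem _ _)))
    (lower δ) (dom δ)).1 (fun _ hz => subset_lower.1 hz) ⟨σ, s.image_mem hσ⟩ fun z hz => by
      obtain ⟨w, hw, h⟩ := (hσ z.1).1 hz
      exact (show z.1 ∈ j.toFun (lower δ) from h ▸ (s.map_mem_iff _ _).2 hw)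

theorem self_mem (s : Supercompact δ j) : δ ∈ M :=
  s.transClass _ (j.mem δ) δ s.mem_map_self

theorem seedCorrect (s : Supercompact δ j) {A σ : ZFSet.{u}} (hA : A ⊆ δ)
    (hσ : ∀ z, z ∈ σ ↔ ∃ w ∈ lower δ, j.toFun w = z) :
    SeedCorrect (X := M) ⟨δ, s.self_mem⟩ ⟨_, j.mem A⟩ ⟨lower δ, s.lower_mem⟩ ⟨_, j.mem (dom δ)⟩
      ⟨seedMeasure δ j, s.seedMeasure_mem⟩ ⟨_, j.mem δ⟩ ⟨σ, s.image_mem hσ⟩ := by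
  refine ⟨s.seedAbs_map s.self_mem, fun x hx => ?_, s.seedAbs_subset hA, fun x hx => ?_,
    fun c hc => ?_, s.image_mem_map_dom hσ⟩
  · have h := s.seedAbs_map x.2
    have hx' : (⟨_, j.mem x.1⟩ : M) = x := Subtype.ext (s.fix x.1 hx)
    rwa [hx'] at h
  · exact ⟨⟨_, j.mem x.1⟩, (hσ _).2 ⟨x.1, hx, rfl⟩, s.seedAbs_map x.2⟩
  · obtain ⟨w, hw, h⟩ := (hσ c.1).1 hc
    have hwM := s.transClass _ s.lower_mem w hw
    have hc' : (⟨_, j.mem w⟩ : M) = c := Subtype.ext h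
    exact ⟨⟨w, hwM⟩, hw, hc' ▸ s.seedAbs_map hwM⟩

/-- The relation `rank x ≤ rank l` for `x ∈ V_δ` and `l ∈ δ`. -/
noncomputable def rankRel (δ : ZFSet.{u}) : ZFSet.{u} :=
  ZFSet.sep (fun t => ∃ x l : ZFSet.{u}, t = ZFSet.pair x l ∧ x.rank ≤ l.rank)
    (ZFSet.prod (ZFSet.vonNeumann δ.rank) δ)

theorem pair_mem_rankRel {x l : ZFSet.{u}} :
    ZFSet.pair x l ∈ rankRel δ ↔ l ∈ δ ∧ x.rank ≤ l.rank := by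
  rw [rankRel, ZFSet.mem_sep, ZFSet.pair_mem_prod]
  constructor
  · rintro ⟨⟨-, hl⟩, x', l', he, h⟩
    obtain ⟨rfl, rfl⟩ := ZFSet.pair_inj.1 he
    exact ⟨hl, h⟩
  · rintro ⟨hl, h⟩
    exact ⟨⟨ZFSet.mem_vonNeumann.2 (h.trans_lt (ZFSet.rank_lt_of_mem hl)), hl⟩, x, l, rfl, h⟩

theorem rank_le_of_pair_mem_map (s : Supercompact δ j) (x : ZFSet.{u}) :
    ∀ l, ZFSet.pair x l ∈ j.toFun (rankRel δ) → x.rank ≤ l.rank := by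
  have key := (transfer₁ j (fun _ _ L => ∀ x l, PrMem L x l → ∀ y, Mm y x →
    ∃ m, Mm m l ∧ PrMem L y m)
    (.all (.all (.imp (.prMem _ _ _) (.all (.imp (.mem _ _) (.ex (.and (.mem _ _)
      (.prMem _ _ _)))))))) (rankRel δ)).1 (fun x l h y hy => by
        rw [prMem_iff, pair_mem_rankRel] at h
        obtain ⟨m, hm, hym⟩ := ZFSet.lt_rank_iff.1 ((ZFSet.rank_lt_of_mem hy).trans_le h.2)
        exact ⟨m, hm, (prMem_iff _ _ _).2 (pair_mem_rankRel.2
          ⟨s.isOrdinal.isTransitive.mem_trans hm h.1, hym⟩)⟩)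
  simp only [s.isSetModel.prMem_iff, s.isSetModel.mem_iff] at key
  induction x using ZFSet.inductionOn with | _ x ih
  intro l h
  obtain ⟨hxM, hlM⟩ := s.mem_of_pair_mem (j.mem _) h
  refine ZFSet.rank_le_iff.2 fun y hy => ?_
  obtain ⟨m, hm, hym⟩ := key ⟨x, hxM⟩ ⟨l, hlM⟩ h ⟨y, s.transClass _ hxM y hy⟩ hy
  exact (ih y hy _ hym).trans_lt (ZFSet.rank_lt_of_mem hm)

theorem bigDomain (s : Supercompact δ j) (hK : ZFSet.vonNeumann δ.rank ∈ M) :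
    BigDomain (X := M) ⟨δ, s.self_mem⟩ ⟨_, j.mem (rankRel δ)⟩ ⟨lower δ, s.lower_mem⟩
      ⟨dom δ, s.dom_mem⟩ ⟨_, j.mem (dom δ)⟩ ⟨_, j.mem δ⟩ ⟨_, hK⟩ := by
  simp only [BigDomain, Incl, TransSet, s.isSetModel.prMem_iff, s.isSetModel.mem_iff]
  refine ⟨s.mem_map_self, fun z hz => s.map_subset (fun _ => mem_dom_of_mem) z hz,
    fun z hz => mem_dom_of_mem hz, fun x l hl h => ?_, ?_, fun x hx y hy => ?_,
    fun z hz => lower_subset hz, fun x hx => ?_, fun x hx y hy => dom_trans hx hy,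
    fun x hx y hy => s.map_transSet (fun x hx y hy => dom_trans hx hy) x hx y hy⟩
  · exact ZFSet.mem_vonNeumann.2
      ((s.rank_le_of_pair_mem_map _ _ h).trans_lt (ZFSet.rank_lt_of_mem hl))
  · exact mem_lower.2 (by
      rw [ZFSet.rank_vonNeumann]
      exact lt_add_of_pos_right _ Ordinal.omega0_pos)
  · exact (ZFSet.isTransitive_vonNeumann _).mem_trans hy hx
  · have h : ZFSet.powerset x.1 ∈ lower δ := by
      rw [mem_lower, ZFSet.rank_powerset]
      exact (Ordinal.isSuccLimit_add _ Ordinal.isSuccLimit_omega0).succ_lt (mem_lower.1 hx)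
    exact ⟨⟨_, s.transClass _ s.lower_mem _ h⟩, h, fun z hz => ZFSet.mem_powerset.2 fun y hy =>
      hz ⟨y, s.transClass _ z.2 y hy⟩ hy⟩

theorem seedFIP (s : Supercompact δ j) {q : ZFSet.{u}} (hq : Coding δ q) :
    SeedFIP (X := M) ⟨seedMeasure δ j, s.seedMeasure_mem⟩ ⟨q, s.coding_mem hq⟩ ⟨_, j.mem q⟩
      ⟨_, j.mem Ordinal.omega0.{u}.toZFSet⟩ := by
  simp only [SeedFIP, s.isSetModel.trMem_iff, s.isSetModel.mem_iff, s.isSetModel.prMem_iff,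
    s.pair_mem_seedMeasure, s.map_omega]
  intro g hg hg'
  obtain ⟨D, hD⟩ : ∃ D : ZFSet.{u} → Prop,
      ∀ n, D n ↔ ∃ c Y, ZFSet.pair n (ZFSet.pair c Y) ∈ g.1 := ⟨_, fun _ => Iff.rfl⟩
  have : ∀ n, ∃ c Y, D n → ZFSet.pair n (ZFSet.pair c Y) ∈ g.1 := fun n => by
    by_cases h : D n
    · obtain ⟨c, Y, h⟩ := (hD n).1 h
      exact ⟨c, Y, fun _ => h⟩
    · exact ⟨∅, ∅, fun h' => absurd h' h⟩
  choose a X haX using this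
  have hDω : ∀ n, D n → n ∈ Ordinal.omega0.{u}.toZFSet ∧ (∀ z ∈ X n, z ∈ dom δ) ∧
      a n ∈ j.toFun (X n) := fun n hn => by
    obtain ⟨hnM, haM, hXM⟩ := s.mem_of_triple_mem g.2 (haX n hn)
    exact hg ⟨n, hnM⟩ ⟨_, haM⟩ ⟨_, hXM⟩ (haX n hn)
  have huniq : ∀ n c Y, ZFSet.pair n (ZFSet.pair c Y) ∈ g.1 → D n ∧ c = a n ∧ Y = X n := by
    intro n c Y h
    have hn : D n := (hD n).2 ⟨c, Y, h⟩
    obtain ⟨hnM, haM, hXM⟩ := s.mem_of_triple_mem g.2 (haX n hn)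
    obtain ⟨-, hcM, hYM⟩ := s.mem_of_triple_mem g.2 h
    exact ⟨hn, (hg' ⟨n, hnM⟩ ⟨c, hcM⟩ ⟨Y, hYM⟩ ⟨_, haM⟩ ⟨_, hXM⟩ h (haX n hn)).imp
      (congrArg Subtype.val) (congrArg Subtype.val)⟩
  have hrank : ∀ n ∈ Ordinal.omega0.{u}.toZFSet, n.rank < δ.rank + Ordinal.omega0 + 2 := by
    intro n hn
    refine rank_lt_of_mem_dom (mem_dom.2 ?_)
    have := ZFSet.rank_lt_of_mem hn
    rw [Ordinal.rank_toZFSet] at this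
    exact this.le.trans le_add_self
  have haI : ∀ n, D n → a n ∈ j.toFun (dom δ) := fun n hn =>
    s.map_subset (hDω n hn).2.1 _ (hDω n hn).2.2
  have haM : ∀ n, D n → a n ∈ M := fun n hn => s.transClass _ (j.mem _) _ (haI n hn)
  have hnM : ∀ n, D n → n ∈ M := fun n hn => s.mem_of_rank_lt n (hrank n (hDω n hn).1)
  obtain ⟨Q₁, hQ₁⟩ : ∃ Q : ZFSet.{u}, ∀ n Y, ZFSet.pair n Y ∈ Q ↔ D n ∧ Y = X n := by
    refine ⟨ZFSet.sep (fun t => ∃ n, D n ∧ t = ZFSet.pair n (X n))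
      (ZFSet.prod Ordinal.omega0.{u}.toZFSet (ZFSet.powerset (dom δ))), fun n Y => ?_⟩
    rw [ZFSet.mem_sep, ZFSet.pair_mem_prod, ZFSet.mem_powerset]
    constructor
    · rintro ⟨-, m, hm, he⟩
      obtain ⟨rfl, rfl⟩ := ZFSet.pair_inj.1 he
      exact ⟨hm, rfl⟩
    · rintro ⟨hn, rfl⟩
      exact ⟨⟨(hDω n hn).1, (hDω n hn).2.1⟩, n, hn, rfl⟩
  obtain ⟨Q₂, hQ₂⟩ : ∃ Q : ZFSet.{u}, ∀ n m, ZFSet.pair n m ∈ Q ↔ D n ∧ D m ∧ a n = a m := by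
    refine ⟨ZFSet.sep (fun t => ∃ n m, (D n ∧ D m ∧ a n = a m) ∧ t = ZFSet.pair n m)
      (ZFSet.prod Ordinal.omega0.{u}.toZFSet Ordinal.omega0.{u}.toZFSet), fun n m => ?_⟩
    rw [ZFSet.mem_sep, ZFSet.pair_mem_prod]
    constructor
    · rintro ⟨-, n', m', h, he⟩
      obtain ⟨rfl, rfl⟩ := ZFSet.pair_inj.1 he
      exact h
    · exact fun h => ⟨⟨(hDω n h.1).1, (hDω m h.2.1).1⟩, n, m, h, rfl⟩
  obtain ⟨Q₃, hQ₃⟩ : ∃ Q : ZFSet.{u}, ∀ n m k, ZFSet.pair n (ZFSet.pair m k) ∈ Q ↔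
      D n ∧ D m ∧ D k ∧ ZFSet.pair (a n) (ZFSet.pair (a m) (a k)) ∈ j.toFun q := by
    refine ⟨ZFSet.sep (fun t => ∃ n m k, (D n ∧ D m ∧ D k ∧
        ZFSet.pair (a n) (ZFSet.pair (a m) (a k)) ∈ j.toFun q) ∧
        t = ZFSet.pair n (ZFSet.pair m k))
      (ZFSet.prod Ordinal.omega0.{u}.toZFSet (ZFSet.prod Ordinal.omega0.{u}.toZFSet
        Ordinal.omega0.{u}.toZFSet)), fun n m k => ?_⟩
    rw [ZFSet.mem_sep, ZFSet.pair_mem_prod, ZFSet.pair_mem_prod]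
    constructor
    · rintro ⟨-, n', m', k', h, he⟩
      obtain ⟨rfl, he'⟩ := ZFSet.pair_inj.1 he
      obtain ⟨rfl, rfl⟩ := ZFSet.pair_inj.1 he'
      exact h
    · exact fun h => ⟨⟨(hDω n h.1).1, (hDω m h.2.1).1, (hDω k h.2.2.1).1⟩, n, m, k, h, rfl⟩
  have hmapQ₁ : ∀ n Y, ZFSet.pair n Y ∈ j.toFun Q₁ → D n ∧ Y = j.toFun (X n) := by
    intro n Y h
    obtain ⟨hnM, hYM⟩ := s.mem_of_pair_mem (j.mem Q₁) h
    have hω := (transfer₂ j (fun _ _ Q w => ∀ n Y, PrMem Q n Y → Mm n w)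
      (.all (.all (.imp (.prMem _ _ _) (.mem _ _)))) Q₁ Ordinal.omega0.{u}.toZFSet).1
      (fun n Y h => (hDω n ((hQ₁ n Y).1 ((prMem_iff _ _ _).1 h)).1).1) ⟨n, hnM⟩ ⟨Y, hYM⟩
      ((s.isSetModel.prMem_iff _ _ _).2 h)
    rw [s.isSetModel.mem_iff] at hω
    have hn : n ∈ Ordinal.omega0.{u}.toZFSet := by
      rw [← s.map_omega]
      exact hω
    have hfix : (⟨_, j.mem n⟩ : M) = ⟨n, hnM⟩ := Subtype.ext (s.map_of_mem_omega hn)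
    by_cases hDn : D n
    · have := (transfer₃ j (fun _ _ Q n X => ∀ Y, PrMem Q n Y → Y = X)
        (.all (.imp (.prMem _ _ _) (.eq _ _))) Q₁ n (X n)).1
        (fun Y h => ((hQ₁ n Y).1 ((prMem_iff _ _ _).1 h)).2) ⟨Y, hYM⟩
      rw [hfix, s.isSetModel.prMem_iff] at this
      exact ⟨hDn, congrArg Subtype.val (this h)⟩
    · have := (transfer₂ j (fun _ _ Q n => ∀ Y, ¬ PrMem Q n Y)
        (.all (.not (.prMem _ _ _))) Q₁ n).1
        (fun Y h => hDn ((hQ₁ n Y).1 ((prMem_iff _ _ _).1 h)).1) ⟨Y, hYM⟩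
      rw [hfix, s.isSetModel.prMem_iff] at this
      exact absurd h this
  have hmapω : ∀ n, D n → j.toFun n = n := fun n hn => s.map_of_mem_omega (hDω n hn).1
  obtain ⟨h₀, hh₀⟩ : ∃ h : ZFSet.{u}, ∀ t, t ∈ h ↔ ∃ n, D n ∧ t = ZFSet.pair n (a n) := by
    refine ⟨ZFSet.sep (fun t => ∃ n, D n ∧ t = ZFSet.pair n (a n))
      (ZFSet.prod Ordinal.omega0.{u}.toZFSet (j.toFun (dom δ))), fun t => ?_⟩
    rw [ZFSet.mem_sep, and_iff_right_iff_imp]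
    rintro ⟨n, hn, rfl⟩
    exact ZFSet.pair_mem_prod.2 ⟨(hDω n hn).1, haI n hn⟩
  have hh₀M : h₀ ∈ M := s.mem_of_image h₀ (fun t ht => by
    obtain ⟨n, hn, rfl⟩ := (hh₀ t).1 ht
    exact s.pair_mem (hnM n hn) (haM n hn)) (fun n => ZFSet.pair n (a n)) fun t ht => by
      obtain ⟨n, hn, rfl⟩ := (hh₀ t).1 ht
      exact ⟨n, hrank n (hDω n hn).1, rfl⟩
  have hpair₀ : ∀ n x, ZFSet.pair n x ∈ h₀ → D n ∧ x = a n := fun n x h => by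
    obtain ⟨m, hm, he⟩ := (hh₀ _).1 h
    obtain ⟨rfl, rfl⟩ := ZFSet.pair_inj.1 he
    exact ⟨hm, rfl⟩
  have key := (transfer₄ j (fun _ _ Q₁ Q₂ Q₃ q => ∃ h,
      (∀ n Y, PrMem Q₁ n Y → ∃ x, Mm x Y ∧ PrMem h n x) ∧
      (∀ n m x y, PrMem h n x → PrMem h m y → PrMem Q₂ n m → x = y) ∧
      ∀ n m k x y z, PrMem h n x → PrMem h m y → PrMem h k z → TrMem Q₃ n m k → TrMem q x y z)
    (by
      repeat' first
        | exact FODef.mem _ _ | exact FODef.eq _ _ | exact FODef.prMem _ _ _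
        | exact FODef.trMem _ _ _ _ | apply FODef.ex | apply FODef.all | apply FODef.and
        | apply FODef.imp) Q₁ Q₂ Q₃ q).2 (by
      simp only [s.isSetModel.trMem_iff, s.isSetModel.mem_iff, s.isSetModel.prMem_iff]
      refine ⟨⟨h₀, hh₀M⟩, fun n Y h => ?_, fun n m x y h1 h2 h3 => ?_,
        fun n m k x y z h1 h2 h3 h4 => ?_⟩
      · obtain ⟨hn, hY⟩ := hmapQ₁ n Y h
        exact ⟨⟨a n, haM _ hn⟩, hY ▸ (hDω _ hn).2.2, (hh₀ _).2 ⟨n, hn, rfl⟩⟩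
      · obtain ⟨hn, hx⟩ := hpair₀ _ _ h1
        obtain ⟨hm, hy⟩ := hpair₀ _ _ h2
        rw [← hmapω _ hn, ← hmapω _ hm, ← s.map_pair, s.map_mem_iff, hQ₂] at h3
        exact Subtype.ext (hx.trans (h3.2.2.trans hy.symm))
      · obtain ⟨hn, hx⟩ := hpair₀ _ _ h1
        obtain ⟨hm, hy⟩ := hpair₀ _ _ h2
        obtain ⟨hk, hz⟩ := hpair₀ _ _ h3
        rw [← hmapω _ hn, ← hmapω _ hm, ← hmapω _ hk, ← s.map_pair, ← s.map_pair, s.map_mem_iff,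
          hQ₃] at h4
        rw [hx, hy, hz]
        exact h4.2.2.2)
  simp only [mm_iff, prMem_iff, trMem_iff] at key
  obtain ⟨h, hh₁, hh₂, hh₃⟩ := key
  have : ∀ n, ∃ x, D n → x ∈ X n ∧ ZFSet.pair n x ∈ h := fun n => by
    by_cases hn : D n
    · exact (hh₁ n (X n) ((hQ₁ _ _).2 ⟨hn, rfl⟩)).imp fun x hx _ => hx
    · exact ⟨∅, fun h' => absurd h' hn⟩
  choose x hx using this
  have hxI : ∀ n, D n → x n ∈ dom δ := fun n hn => (hDω n hn).2.1 _ (hx n hn).1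
  have hxM : ∀ n, D n → x n ∈ M := fun n hn => s.mem_of_rank_lt _ (rank_lt_of_mem_dom (hxI n hn))
  obtain ⟨H, hH⟩ : ∃ H : ZFSet.{u}, ∀ t, t ∈ H ↔ ∃ n, D n ∧ t = ZFSet.pair (a n) (x n) := by
    refine ⟨ZFSet.sep (fun t => ∃ n, D n ∧ t = ZFSet.pair (a n) (x n))
      (ZFSet.prod (j.toFun (dom δ)) (dom δ)), fun t => ?_⟩
    rw [ZFSet.mem_sep, and_iff_right_iff_imp]
    rintro ⟨n, hn, rfl⟩
    exact ZFSet.pair_mem_prod.2 ⟨haI n hn, hxI n hn⟩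
  have hHM : H ∈ M := s.mem_of_image H (fun t ht => by
    obtain ⟨n, hn, rfl⟩ := (hH t).1 ht
    exact s.pair_mem (haM n hn) (hxM n hn)) (fun n => ZFSet.pair (a n) (x n)) fun t ht => by
      obtain ⟨n, hn, rfl⟩ := (hH t).1 ht
      exact ⟨n, hrank n (hDω n hn).1, rfl⟩
  have hpair : ∀ c z, ZFSet.pair c z ∈ H → ∃ n, D n ∧ c = a n ∧ z = x n := fun c z h => by
    obtain ⟨n, hn, he⟩ := (hH _).1 h
    exact ⟨n, hn, ZFSet.pair_inj.1 he⟩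
  refine ⟨⟨H, hHM⟩, fun n c Y h => ?_, fun c z z' h h' => ?_, fun c z b y e w h1 h2 h3 h4 => ?_⟩
  · obtain ⟨hn, hc, hY⟩ := huniq _ _ _ h
    exact ⟨⟨x n, hxM _ hn⟩, hY ▸ (hx _ hn).1, (hH _).2 ⟨n, hn, by rw [hc]⟩⟩
  · obtain ⟨n, hn, hc, hz⟩ := hpair _ _ h
    obtain ⟨m, hm, hc', hz'⟩ := hpair _ _ h'
    exact Subtype.ext (hz.trans ((hh₂ n m _ _ (hx n hn).2 (hx m hm).2
      ((hQ₂ n m).2 ⟨hn, hm, hc.symm.trans hc'⟩)).trans hz'.symm))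
  · obtain ⟨n, hn, hc, hz⟩ := hpair _ _ h1
    obtain ⟨m, hm, hb, hy⟩ := hpair _ _ h2
    obtain ⟨k, hk, he, hw⟩ := hpair _ _ h3
    rw [hc, hb, he] at h4
    rw [hz, hy, hw]
    exact hh₃ n m k _ _ _ (hx n hn).2 (hx m hm).2 (hx k hk).2 ((hQ₃ n m k).2 ⟨hn, hm, hk, h4⟩)

theorem mem_map_club (s : Supercompact δ j) {C : Set Ordinal.{u}} {B : ZFSet.{u}}
    (hB : ∀ k, k ∈ B ↔ k ∈ δ ∧ k.rank ∈ C)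
    (hCδ : C ⊆ Set.Iio δ.rank)
    (hclosed : ∀ t : Set Ordinal.{u}, t ⊆ C → t.Nonempty → sSup t < δ.rank → sSup t ∈ C)
    (hunbdd : ∀ α < δ.rank, ∃ β ∈ C, α ≤ β) : δ ∈ j.toFun B := by
  have key := (transfer₂ j (fun _ _ d B => ∀ k, Mm k d → (∃ b, Mm b k) →
      (∀ b, Mm b k → ∃ c, Mm c k ∧ Mm c B ∧ Mm b c) → Mm k B)
    (by
      repeat' first
        | exact FODef.mem _ _ | apply FODef.ex | apply FODef.all | apply FODef.and
        | apply FODef.imp) δ B).1 (by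
      simp only [mm_iff]
      rintro k hk ⟨b, hb⟩ h
      have hsup : sSup {o | ∃ c ∈ k, c ∈ B ∧ o = c.rank} = k.rank := by
        have hle : ∀ o ∈ {o | ∃ c ∈ k, c ∈ B ∧ o = c.rank}, o ≤ k.rank := by
          rintro o ⟨c, hc, -, rfl⟩
          exact (ZFSet.rank_lt_of_mem hc).le
        obtain ⟨c, hc, hcB, -⟩ := h b hb
        refine le_antisymm (csSup_le ⟨_, c, hc, hcB, rfl⟩ hle) (ZFSet.rank_le_iff.2 fun y hy => ?_)
        obtain ⟨c, hc, hcB, hyc⟩ := h y hy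
        exact (ZFSet.rank_lt_of_mem hyc).trans_le (le_csSup ⟨_, hle⟩ ⟨c, hc, hcB, rfl⟩)
      obtain ⟨c, hc, hcB, -⟩ := h b hb
      refine (hB k).2 ⟨hk, hsup ▸ hclosed _ ?_ ⟨_, c, hc, hcB, rfl⟩
        (hsup ▸ ZFSet.rank_lt_of_mem hk)⟩
      rintro o ⟨c, -, hcB, rfl⟩
      exact ((hB c).1 hcB).2)
  obtain ⟨b, hb⟩ := s.exists_mem
  have hM : ∀ x ∈ δ, x ∈ M := fun x hx => s.transClass _ s.self_mem x hx
  refine key ⟨δ, s.self_mem⟩ s.mem_map_self ⟨⟨b, hM b hb⟩, hb⟩ fun b hb => ?_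
  obtain ⟨o, ho, hbo⟩ := hunbdd (insert b.1 b.1).rank
    (ZFSet.rank_lt_of_mem (s.insert_self_mem hb))
  have hoδ : o.toZFSet ∈ δ := by
    rw [← s.isOrdinal.toZFSet_rank_eq, Ordinal.toZFSet_mem_toZFSet_iff]
    exact hCδ ho
  refine ⟨⟨o.toZFSet, hM _ hoδ⟩, hoδ, ?_, ?_⟩
  · have : j.toFun o.toZFSet ∈ j.toFun B :=
      (s.map_mem_iff _ _).2 ((hB _).2 ⟨hoδ, by rwa [Ordinal.rank_toZFSet]⟩)
    rwa [s.fix _ hoδ] at this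
  · have hb' : b.1.rank < o :=
      (ZFSet.rank_lt_of_mem (ZFSet.mem_insert b.1 b.1)).trans_le hbo
    have hbδ : b.1 ∈ δ := hb
    change b.1 ∈ o.toZFSet
    rwa [← (s.isOrdinal.mem hbδ).toZFSet_rank_eq, Ordinal.toZFSet_mem_toZFSet_iff]

theorem reflected (s : Supercompact δ j) {A B : ZFSet.{u}} (hA : A ⊆ δ) (hB : δ ∈ j.toFun B) :
    Reflected B A (rankRel δ) Ordinal.omega0.{u}.toZFSet := by
  obtain ⟨q, hq⟩ := exists_coding δ
  obtain ⟨σ, hσ⟩ := exists_image j (lower δ)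
  have hK : ZFSet.vonNeumann δ.rank ∈ M := s.transClass _ s.lower_mem _ (by
    rw [mem_lower, ZFSet.rank_vonNeumann]
    exact lt_add_of_pos_right _ Ordinal.omega0_pos)
  exact (transfer₄ j (fun _ _ C A L w => Reflected C A L w) .reflected B A (rankRel δ)
    Ordinal.omega0.{u}.toZFSet).2 ⟨⟨δ, s.self_mem⟩, ⟨lower δ, s.lower_mem⟩, ⟨dom δ, s.dom_mem⟩,
      ⟨_, j.mem (dom δ)⟩, ⟨seedMeasure δ j, s.seedMeasure_mem⟩, ⟨q, s.coding_mem hq⟩,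
      ⟨_, j.mem q⟩, ⟨_, j.mem δ⟩, ⟨σ, s.image_mem hσ⟩, ⟨_, hK⟩, hB, s.bigDomain hK, s.seedUltra,
      s.seedFIP hq, s.seedPairing hq, s.seedClosed hq, s.seedMem hq, s.seedCorrect hA hσ⟩

end Supercompact

end Superstrong

/-- Suppose `δ` is `|V_{δ+ω+2}|`-supercompact, witnessed by an elementary embedding
`j : V → M` with critical point `δ` and `M^{V_{δ+ω+2}} ⊆ M` (the restriction of any
class function to `V_{δ+ω+2}` belongs to `M`).  Then for every `A ⊆ δ` there are
stationarily many `κ < δ` which are `[|V_{κ+ω}|] A`-superstrong: for every club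
`C ⊆ δ` there is `κ ∈ C` and an elementary embedding `i : V → N` with critical
point `κ`, `i(A) ∩ i(κ) = A ∩ i(κ)`, and `i''V_{κ+ω} ∈ N`. -/
theorem stmt17 (δ : ZFSet.{u}) (hδ : IsOrd δ)
    (M : Set ZFSet.{u}) (hMtrans : TransClass M) (j : ElemEmbInto M)
    (hfix : ∀ x ∈ δ, j.toFun x = x) (hcrit : j.toFun δ ≠ δ)
    (hclosed : ∀ s : ZFSet.{u} → ZFSet.{u}, (∀ x : ZFSet.{u}, s x ∈ M) →
      ∃ w ∈ M, ∀ f : ZFSet.{u}, f ∈ w ↔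
        ∃ x : ZFSet.{u}, x.rank < δ.rank + Ordinal.omega0 + 2 ∧ f = ZFSet.pair x (s x)) :
    ∀ A : ZFSet.{u}, A ⊆ δ →
      ∀ C : Set Ordinal.{u}, C ⊆ Set.Iio δ.rank →
        (∀ s : Set Ordinal.{u}, s ⊆ C → s.Nonempty → sSup s < δ.rank → sSup s ∈ C) →
        (∀ α < δ.rank, ∃ β ∈ C, α ≤ β) →
        ∃ κ ∈ C, ∃ (N : Set ZFSet.{u}) (i : ElemEmbInto N), TransClass N ∧
          (∀ x : ZFSet.{u}, IsOrd x → x.rank < κ → i.toFun x = x) ∧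
          (∃ k : ZFSet.{u}, IsOrd k ∧ k.rank = κ ∧ i.toFun k ≠ k ∧
            i.toFun A ∩ i.toFun k = A ∩ i.toFun k) ∧
          (∃ w ∈ N, ∀ z : ZFSet.{u},
            z ∈ w ↔ ∃ x : ZFSet.{u}, x.rank < κ + Ordinal.omega0 ∧ z = i.toFun x) := by
  intro A hA C hCδ hC hunbdd
  have s : Superstrong.Supercompact δ j := ⟨hδ, hMtrans, hfix, hcrit, hclosed⟩
  obtain ⟨B, hB⟩ : ∃ B : ZFSet.{u}, ∀ k, k ∈ B ↔ k ∈ δ ∧ k.rank ∈ C :=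
    ⟨ZFSet.sep (fun k => k.rank ∈ C) δ, fun _ => ZFSet.mem_sep⟩
  have hord : ∀ k ∈ B, IsOrd k := fun k hk =>
    ⟨hδ.2 k ((hB k).1 hk).1, fun y hy => hδ.2 y (hδ.1.mem_trans hy ((hB k).1 hk).1)⟩
  obtain ⟨k, hk, N, i, hN, hi, hik, hiA, hw⟩ :=
    (s.reflected hA (s.mem_map_club hB hCδ hC hunbdd)).exists_embedding hord
      fun k hk l hl x hx => Superstrong.Supercompact.pair_mem_rankRel.2
        ⟨hδ.1.mem_trans hl ((hB k).1 hk).1, hx⟩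
  exact ⟨k.rank, ((hB k).1 hk).2, N, i, hN, hi, ⟨k, hord k hk, rfl, hik, hiA⟩, hw⟩
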